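/- Let N be a Niemeier lattice whose set of roots R = {r ∈ N : B(r, r) = 2} is nonempty, let h = |R|/24 ∈ ℚ be its Coxeter number, and let ρ ∈ N ⊗ ℚ be the Weyl vector relative to a ℚ-linear functional f nonvanishing on R. Then for every y ∈ N, B(ρ − h·y, ρ − h·y) ≥ 2h(h+1) (equivalently (ρ/h − y)² ≥ 2(1 + 1/h)), with equality if and only if B(y, r) ∈ {0, 1} for every positive root r. Moreover the y for which equality holds form a complete set of representatives of N modulo the ℤ-span of R: for every x ∈ N there is exactly one y ∈ N attaining equality with x − y in the ℤ-span of R. -/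

import Mathlib

namespace Niemeier

section Poisson

open MeasureTheory Set UnitAddTorus Complex
open scoped Real

variable {ι : Type*} [Fintype ι]

lemma hasSum_setIntegral_translate {h : (ι → ℝ) → ℂ} (hh : Integrable h) :
    HasSum (fun n : ι → ℤ ↦ ∫ x in {x : ι → ℝ | ∀ i, x i ∈ Ioc (0 : ℝ) (0 + 1)},
      h (x + fun i ↦ (n i : ℝ))) (∫ x, h x) := by
  set box : Set (ι → ℝ) := {x : ι → ℝ | ∀ i, x i ∈ Ioc (0 : ℝ) (0 + 1)}
  have hbox : MeasurableSet box := MeasurableSet.univ_pi' fun _ ↦ measurableSet_Ioc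
  let s : (ι → ℤ) → Set (ι → ℝ) := fun n ↦ Set.image (fun x ↦ x + fun i ↦ ((n i : ℤ) : ℝ)) box
  have key : ∀ n : ι → ℤ, ∀ x : ι → ℝ, x ∈ s n ↔ ∀ i, ⌈x i⌉ = n i + 1 := by
    intro n x
    simp only [s, box, image_add_right, mem_preimage, mem_ofPred_eq, Pi.add_apply, Pi.neg_apply,
      mem_Ioc]
    refine forall_congr' fun i ↦ ?_
    rw [Int.ceil_eq_iff]
    push_cast
    constructor <;> rintro ⟨h1, h2⟩ <;> constructor <;> linarith
  have hs : ∀ n, MeasurableSet (s n) := fun n ↦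
    (MeasurableEquiv.addRight _).measurableEmbedding.measurableSet_image.mpr hbox
  have hd : Pairwise (Function.onFun Disjoint s) := by
    intro m n hmn
    refine Set.disjoint_left.mpr fun x hx hx' ↦ hmn (funext fun i ↦ ?_)
    have h1 := (key m x).mp hx i
    have h2 := (key n x).mp hx' i
    lia
  have hU : (⋃ n, s n) = univ := by
    refine eq_univ_of_forall fun x ↦ mem_iUnion.mpr ⟨fun i ↦ ⌈x i⌉ - 1, ?_⟩
    rw [key]
    intro i
    ring
  have := hasSum_integral_iUnion hs hd (f := h) (μ := volume) hh.integrableOn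
  rw [hU, setIntegral_univ] at this
  refine this.congr_fun fun n ↦ ?_
  exact ((measurePreserving_add_right volume (fun i ↦ ((n i : ℤ) : ℝ))).setIntegral_image_emb
    (MeasurableEquiv.addRight _).measurableEmbedding h box).symm

lemma mFourier_coe (m : ι → ℤ) (x : ι → ℝ) :
    mFourier m (fun i ↦ (x i : UnitAddCircle)) = cexp (2 * π * I * ∑ i, (m i : ℂ) * x i) := by
  simp only [mFourier, ContinuousMap.coe_mk, fourier_coe_apply, ← Complex.exp_sum,
    Finset.mul_sum]
  congr 1
  refine Finset.sum_congr rfl fun i _ ↦ ?_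
  push_cast
  ring

/-- **Poisson summation** for the lattice `ι → ℤ` in `ι → ℝ`. -/
theorem tsum_translate_eq_tsum_fourier {g : (ι → ℝ) → ℂ} (hg : Integrable g)
    (hcont : Continuous fun x : ι → ℝ ↦ ∑' n : ι → ℤ, g (x + fun i ↦ (n i : ℝ)))
    (hsum : Summable fun m : ι → ℤ ↦
      ∫ x : ι → ℝ, cexp (-(2 * π * I * ∑ i, (m i : ℂ) * x i)) * g x) (x : ι → ℝ) :
    ∑' n : ι → ℤ, g (x + fun i ↦ (n i : ℝ)) =
      ∑' m : ι → ℤ, (∫ y : ι → ℝ, cexp (-(2 * π * I * ∑ i, (m i : ℂ) * y i)) * g y) *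
        cexp (2 * π * I * ∑ i, (m i : ℂ) * x i) := by
  set F : (ι → ℝ) → ℂ := fun x ↦ ∑' n : ι → ℤ, g (x + fun i ↦ (n i : ℝ)) with hF
  have hper : ∀ (x : ι → ℝ) (k : ι → ℤ), F (x + fun i ↦ (k i : ℝ)) = F x := by
    intro x k
    simp only [hF]
    rw [← (Equiv.addLeft k).tsum_eq (fun n : ι → ℤ ↦ g (x + fun i ↦ (n i : ℝ)))]
    refine tsum_congr fun n ↦ ?_
    congr 1
    ext i
    simp [add_assoc]
  let π' : (ι → ℝ) → UnitAddTorus ι := Pi.map fun _ (t : ℝ) ↦ (t : UnitAddCircle)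
  have hπ' : IsOpenQuotientMap π' :=
    IsOpenQuotientMap.piMap fun _ ↦ QuotientAddGroup.isOpenQuotientMap_mk
  have hlift : ∀ x y : ι → ℝ, π' x = π' y → F x = F y := by
    intro x y hxy
    have : ∀ i, ∃ k : ℤ, x i = y i + k := by
      intro i
      have := congrFun hxy i
      simp only [π', Pi.map_apply] at this
      rw [← sub_eq_zero, ← AddCircle.coe_sub, AddCircle.coe_eq_zero_iff] at this
      obtain ⟨k, hk⟩ := this
      exact ⟨k, by simp at hk; linarith⟩
    choose k hk using this
    rw [← hper y k]
    congr 1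
    exact funext hk
  let F' : UnitAddTorus ι → ℂ := fun z ↦ F (Function.surjInv hπ'.surjective z)
  have hF' : ∀ x, F' (π' x) = F x := fun x ↦
    hlift _ _ (Function.surjInv_eq hπ'.surjective _)
  have hF'c : Continuous F' := by
    rw [hπ'.isQuotientMap.continuous_iff]
    exact hcont.congr fun x ↦ (hF' x).symm
  let Fc : C(UnitAddTorus ι, ℂ) := ⟨F', hF'c⟩
  have hnorm : ∀ (m : ι → ℤ) (x : ι → ℝ), ‖cexp (-(2 * π * I * ∑ i, (m i : ℂ) * x i))‖ = 1 := by
    intro m x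
    have : -(2 * π * I * ∑ i, (m i : ℂ) * x i) = ((-(2 * π * ∑ i, (m i : ℝ) * x i) : ℝ) : ℂ) * I := by
      push_cast; ring
    rw [this, Complex.norm_exp_ofReal_mul_I]
  have hexp : ∀ (m n : ι → ℤ) (x : ι → ℝ),
      cexp (-(2 * π * I * ∑ i, (m i : ℂ) * ((x + fun i ↦ (n i : ℝ)) i : ℝ))) =
      cexp (-(2 * π * I * ∑ i, (m i : ℂ) * x i)) := by
    intro m n x
    rw [Complex.exp_eq_exp_iff_exists_int]
    refine ⟨-∑ i, m i * n i, ?_⟩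
    push_cast [Pi.add_apply, mul_add, Finset.sum_add_distrib]
    ring
  have hint : ∀ m : ι → ℤ, Integrable fun x : ι → ℝ ↦
      cexp (-(2 * π * I * ∑ i, (m i : ℂ) * x i)) * g x := by
    intro m
    refine hg.bdd_mul (c := 1) (Continuous.aestronglyMeasurable (by fun_prop))
      (.of_forall fun x ↦ (hnorm m x).le)
  have hcoeff : ∀ m : ι → ℤ, mFourierCoeff F' m =
      ∫ x : ι → ℝ, cexp (-(2 * π * I * ∑ i, (m i : ℂ) * x i)) * g x := by
    intro m
    rw [mFourierCoeff_eq_integral F' m 0]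
    have h1 := hasSum_setIntegral_translate (hint m)
    have h2 := hasSum_setIntegral_translate (hint m).norm.ofReal
    rw [← h1.tsum_eq]
    symm
    have h3 := integral_tsum_of_summable_integral_norm
      (μ := volume.restrict {x : ι → ℝ | ∀ i, x i ∈ Ioc (0 : ℝ) (0 + 1)})
      (F := fun (n : ι → ℤ) (x : ι → ℝ) ↦
        (cexp (-(2 * π * I * ∑ i, (m i : ℂ) * ((x + fun i ↦ (n i : ℝ)) i : ℝ))) *
          g (x + fun i ↦ (n i : ℝ)))) ?_ ?_
    · rw [h3]
      refine integral_congr_ae (.of_forall fun x ↦ ?_)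
      simp only [hexp]
      rw [tsum_mul_left, smul_eq_mul, mFourier_coe]
      have : F' (fun i ↦ (x i : UnitAddCircle)) = F x := hF' x
      rw [this]
      congr 2
      simp
    · intro n
      exact ((hint m).comp_add_right _).integrableOn
    · have h4 := h2.summable.map Complex.reCLM Complex.reCLM.continuous
      refine h4.congr fun n ↦ ?_
      simp only [Function.comp, Complex.reCLM_apply]
      rw [integral_ofReal]
      simp
  have hsum' : Summable (mFourierCoeff Fc) := hsum.congr fun m ↦ (hcoeff m).symm
  have := hasSum_mFourier_series_apply_of_summable hsum' (π' x)
  have h5 : Fc (π' x) = F x := hF' x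
  rw [h5] at this
  refine (this.tsum_eq.symm : F x = _).trans ?_
  refine tsum_congr fun m ↦ ?_
  have h6 : mFourierCoeff Fc m = _ := hcoeff m
  rw [h6, smul_eq_mul]
  congr 1
  exact mFourier_coe m x

end Poisson

section Theta

open MeasureTheory Set Complex Matrix
open scoped Real

variable {ι : Type*} [Fintype ι]

lemma norm_intCast_pi (n : ι → ℤ) : ‖fun i ↦ (n i : ℝ)‖ = ‖n‖ := by
  simp [Pi.norm_def, nnnorm, Int.norm_eq_abs]

lemma summable_norm_pow_inv_pi_int {N : ℕ} (hN : Fintype.card ι < N) :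
    Summable fun n : ι → ℤ ↦ ‖n‖⁻¹ ^ N := by
  classical
  set Λ := Submodule.span ℤ (range (Pi.basisFun ℝ ι))
  have hΛ : Module.finrank ℤ Λ < N := by
    have : Module.finrank ℤ Λ = Module.finrank ℝ (ι → ℝ) := ZLattice.rank ℝ Λ
    rw [this, Module.finrank_fintype_fun_eq_card]
    exact hN
  have hmem : ∀ n : ι → ℤ, (fun i ↦ (n i : ℝ)) ∈ Λ := by
    intro n
    rw [Module.Basis.mem_span_iff_repr_mem]
    intro i
    exact ⟨n i, by simp⟩
  have := (ZLattice.summable_norm_pow_inv Λ N hΛ).comp_injective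
    (i := fun n : ι → ℤ ↦ (⟨fun i ↦ (n i : ℝ), hmem n⟩ : Λ)) (by
      intro n m h
      have h' := congrArg Subtype.val h
      funext i
      exact Int.cast_injective (congrFun h' i))
  refine this.congr fun n ↦ ?_
  change ‖(fun i ↦ (n i : ℝ))‖⁻¹ ^ N = _
  rw [norm_intCast_pi]

lemma exp_neg_mul_sq_add_le {c : ℝ} (hc : 0 < c) (K x : ℝ) :
    rexp (-c * x ^ 2 + K * x) ≤ rexp ((K + 1) ^ 2 / (4 * c)) * rexp (-x) := by
  rw [← Real.exp_add]
  apply Real.exp_le_exp.mpr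
  have : (K + 1) ^ 2 / (4 * c) + -x - (-c * x ^ 2 + K * x) =
      (2 * c * x - (K + 1)) ^ 2 / (4 * c) := by
    field_simp
    ring
  have h2 : 0 ≤ (2 * c * x - (K + 1)) ^ 2 / (4 * c) := by positivity
  linarith

lemma summable_exp_neg_mul_norm_sq_add {c : ℝ} (hc : 0 < c) (K : ℝ) :
    Summable fun n : ι → ℤ ↦ rexp (-c * ‖n‖ ^ 2 + K * ‖n‖) := by
  classical
  set N := Fintype.card ι + 1
  have hS := (summable_norm_pow_inv_pi_int (ι := ι) (N := N) (by simp [N])).mul_left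
    (rexp ((K + 1) ^ 2 / (4 * c)) * N.factorial)
  refine Summable.of_norm_bounded_eventually hS ?_
  have : ({0} : Set (ι → ℤ))ᶜ ∈ Filter.cofinite := by simp
  filter_upwards [this] with n hn
  have hn0 : 0 < ‖n‖ := norm_pos_iff.mpr hn
  rw [Real.norm_eq_abs, abs_of_pos (Real.exp_pos _)]
  refine (exp_neg_mul_sq_add_le hc K ‖n‖).trans ?_
  rw [mul_assoc]
  refine mul_le_mul_of_nonneg_left ?_ (Real.exp_pos _).le
  have h1 := Real.pow_div_factorial_le_exp ‖n‖ hn0.le N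
  rw [Real.exp_neg, inv_pow]
  have h2 : 0 < ‖n‖ ^ N := by positivity
  have h3 : (0 : ℝ) < N.factorial := by positivity
  rw [← div_eq_mul_inv, inv_le_comm₀ (Real.exp_pos _) (by positivity), inv_div]
  exact h1

/-- The quadratic form `x ↦ |Ax|²`. -/
def quad (A : Matrix ι ι ℝ) (x : ι → ℝ) : ℝ := ∑ i, (A *ᵥ x) i ^ 2

/-- The bilinear form `(x, y) ↦ Ax · Ay`. -/
def bil (A : Matrix ι ι ℝ) (x y : ι → ℝ) : ℝ := ∑ i, (A *ᵥ x) i * (A *ᵥ y) i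

lemma quad_nonneg (A : Matrix ι ι ℝ) (x : ι → ℝ) : 0 ≤ quad A x :=
  Finset.sum_nonneg fun _ _ ↦ sq_nonneg _

lemma quad_add (A : Matrix ι ι ℝ) (x y : ι → ℝ) :
    quad A (x + y) = quad A x + 2 * bil A x y + quad A y := by
  simp only [quad, bil, Matrix.mulVec_add, Pi.add_apply, Finset.mul_sum, ← Finset.sum_add_distrib]
  exact Finset.sum_congr rfl fun i _ ↦ by ring

lemma quad_smul (A : Matrix ι ι ℝ) (s : ℝ) (x : ι → ℝ) : quad A (s • x) = s ^ 2 * quad A x := by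
  simp only [quad, Matrix.mulVec_smul, Pi.smul_apply, Finset.mul_sum, smul_eq_mul, mul_pow]

lemma bil_smul_left (A : Matrix ι ι ℝ) (s : ℝ) (x y : ι → ℝ) :
    bil A (s • x) y = s * bil A x y := by
  simp only [bil, Matrix.mulVec_smul, Pi.smul_apply, Finset.mul_sum, smul_eq_mul, mul_assoc]

lemma bil_comm (A : Matrix ι ι ℝ) (x y : ι → ℝ) : bil A x y = bil A y x :=
  Finset.sum_congr rfl fun _ _ ↦ mul_comm _ _

lemma continuous_quad (A : Matrix ι ι ℝ) : Continuous (quad A) := by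
  unfold quad
  fun_prop

lemma exists_mul_norm_sq_le_quad [DecidableEq ι] {A : Matrix ι ι ℝ} (hA : IsUnit A.det) :
    ∃ c > 0, ∀ x, c * ‖x‖ ^ 2 ≤ quad A x := by
  obtain ⟨C, hC, hb⟩ := (LinearMap.toContinuousLinearMap (Matrix.mulVecLin A⁻¹)).bound
  refine ⟨(C ^ 2)⁻¹, by positivity, fun x ↦ ?_⟩
  have h1 : ‖x‖ ≤ C * ‖A *ᵥ x‖ := by
    have := hb (A *ᵥ x)
    simpa [Matrix.mulVec_mulVec, Matrix.nonsing_inv_mul A hA] using this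
  have h2 : ‖A *ᵥ x‖ ≤ √(quad A x) := by
    refine (pi_norm_le_iff_of_nonneg (Real.sqrt_nonneg _)).mpr fun i ↦ ?_
    rw [Real.norm_eq_abs]
    refine Real.abs_le_sqrt ?_
    exact Finset.single_le_sum (f := fun i ↦ (A *ᵥ x) i ^ 2) (fun _ _ ↦ sq_nonneg _)
      (Finset.mem_univ i)
  have h3 : ‖x‖ ^ 2 ≤ C ^ 2 * quad A x := by
    calc ‖x‖ ^ 2 ≤ (C * √(quad A x)) ^ 2 := by gcongr; exact h1.trans (by gcongr)
      _ = _ := by rw [mul_pow, Real.sq_sqrt (quad_nonneg A x)]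
  rw [inv_mul_le_iff₀ (by positivity)]
  exact h3

lemma exists_abs_bil_le (A : Matrix ι ι ℝ) (v : ι → ℝ) :
    ∃ C > 0, ∀ x, |bil A x v| ≤ C * ‖x‖ := by
  let l : (ι → ℝ) →ₗ[ℝ] ℝ :=
    { toFun := fun x ↦ bil A x v
      map_add' := fun x y ↦ by
        simp [bil, Matrix.mulVec_add, add_mul, Finset.sum_add_distrib]
      map_smul' := fun s x ↦ by simp [bil_smul_left] }
  obtain ⟨C, hC, hb⟩ := (LinearMap.toContinuousLinearMap l).bound
  exact ⟨C, hC, fun x ↦ hb x⟩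

/-- The real vector underlying an integer vector. -/
abbrev toReal (n : ι → ℤ) : ι → ℝ := fun i ↦ (n i : ℝ)

end Theta

section Inversion

open MeasureTheory Set Complex Matrix
open scoped Real

variable {ι : Type*} [Fintype ι]

lemma norm_cexp_pi_I_mul (τ : ℂ) (q : ℝ) : ‖cexp (π * I * τ * q)‖ = rexp (-π * τ.im * q) := by
  rw [Complex.norm_exp]
  congr 1
  simp [mul_re, mul_im]

lemma measurePreserving_mulVec [DecidableEq ι] {A : Matrix ι ι ℝ} (hA : |A.det| = 1) :
    MeasurePreserving (fun x : ι → ℝ ↦ A *ᵥ x) := by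
  have h0 : A.det ≠ 0 := by
    intro h
    simp [h] at hA
  refine ⟨(Continuous.matrix_mulVec continuous_const continuous_id).measurable, ?_⟩
  have := Real.map_matrix_volume_pi_eq_smul_volume_pi h0
  rw [abs_inv, hA, inv_one, ENNReal.ofReal_one, one_smul] at this
  exact this

lemma integrable_cexp_quad [DecidableEq ι] {A : Matrix ι ι ℝ} (hA : |A.det| = 1) {τ : ℂ}
    (hτ : 0 < τ.im) : Integrable fun x : ι → ℝ ↦ cexp (π * I * τ * quad A x) := by
  have hb : 0 < (-(π * I * τ)).re := by simp [hτ, Real.pi_pos]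
  have h := GaussianFourier.integrable_cexp_neg_mul_sum_add (ι := ι) hb 0
  have h2 := (measurePreserving_mulVec hA).integrable_comp_of_integrable h
  refine h2.congr (Filter.Eventually.of_forall fun x ↦ ?_)
  simp [quad]

lemma integral_cexp_bil_mul_cexp_quad [DecidableEq ι] {A : Matrix ι ι ℝ} (hA : |A.det| = 1)
    {τ : ℂ} (hτ : 0 < τ.im) (n : ι → ℝ) :
    ∫ x : ι → ℝ, cexp (-(2 * π * I * bil A n x)) * cexp (π * I * τ * quad A x) =
      (I / τ) ^ (Fintype.card ι / 2 : ℂ) * cexp (-(π * I / τ * quad A n)) := by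
  have hτ0 : τ ≠ 0 := by
    rintro rfl
    simp at hτ
  have hb : 0 < (-(π * I * τ)).re := by simp [hτ, Real.pi_pos]
  set c : ι → ℂ := fun i ↦ -(2 * π * I * ((A *ᵥ n) i : ℝ))
  have h := GaussianFourier.integral_cexp_neg_mul_sum_add (ι := ι) hb c
  have hmp := measurePreserving_mulVec hA
  rw [← hmp.map_eq, integral_map hmp.measurable.aemeasurable
    (Continuous.aestronglyMeasurable (by fun_prop))] at h
  have hpi : (π : ℂ) ≠ 0 := by exact_mod_cast Real.pi_ne_zero
  convert h using 1
  · refine integral_congr_ae (Filter.Eventually.of_forall fun x ↦ ?_)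
    simp only [← Complex.exp_add, bil, quad, c]
    congr 1
    push_cast
    simp only [Finset.mul_sum, ← Finset.sum_neg_distrib, ← Finset.sum_add_distrib]
    exact Finset.sum_congr rfl fun i _ ↦ by ring
  · congr 2
    · rw [div_eq_div_iff hτ0 (by simp [hpi, hτ0])]
      linear_combination (-π * τ) * I_sq
    · simp only [c, quad]
      have : ∀ i, (-(2 * π * I * ((A *ᵥ n) i : ℝ))) ^ 2 = -(4 * π ^ 2) * ((A *ᵥ n) i : ℂ) ^ 2 := by
        intro i
        linear_combination (4 * π ^ 2 * ((A *ᵥ n) i : ℂ) ^ 2) * I_sq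
      simp only [this, ← Finset.mul_sum]
      push_cast
      field_simp
      linear_combination (-∑ i, ((A *ᵥ n) i : ℂ) ^ 2) * I_sq

/-- The general term of the Jacobi theta function of the lattice `A ℤ^ι` in the direction `v`. -/
noncomputable def jacobiTerm (A : Matrix ι ι ℝ) (v : ι → ℝ) (τ s : ℂ) (n : ι → ℤ) : ℂ :=
  cexp (π * I * τ * quad A (toReal n) + 2 * π * I * s * bil A (toReal n) v)

lemma norm_jacobiTerm_le [DecidableEq ι] {A : Matrix ι ι ℝ} (hA : IsUnit A.det) (v : ι → ℝ) :
    ∃ c > 0, ∃ C > 0, ∀ (τ s : ℂ) (n : ι → ℤ), 0 ≤ τ.im →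
      ‖jacobiTerm A v τ s n‖ ≤ rexp (-(τ.im * c) * ‖n‖ ^ 2 + ‖s‖ * C * ‖n‖) := by
  obtain ⟨c, hc, hq⟩ := exists_mul_norm_sq_le_quad hA
  obtain ⟨C, hC, hb⟩ := exists_abs_bil_le A v
  refine ⟨π * c, by positivity, 2 * π * C, by positivity, fun τ s n hτ ↦ ?_⟩
  rw [jacobiTerm, Complex.norm_exp]
  apply Real.exp_le_exp.mpr
  rw [add_re]
  have h1 : (π * I * τ * quad A (toReal n)).re = - (τ.im * π * quad A (toReal n)) := by
    simp only [mul_re, mul_im, ofReal_re, ofReal_im, I_re, I_im]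
    ring
  have h2 : (2 * π * I * s * bil A (toReal n) v).re = - (2 * π * (s.im * bil A (toReal n) v)) := by
    simp only [mul_re, mul_im, ofReal_re, ofReal_im, I_re, I_im, re_ofNat, im_ofNat]
    ring
  have h3 : -(s.im * bil A (toReal n) v) ≤ ‖s‖ * (C * ‖n‖) := by
    refine (neg_le_abs _).trans ?_
    rw [abs_mul]
    have := hb (toReal n)
    rw [norm_intCast_pi] at this
    exact mul_le_mul (abs_im_le_norm s) this (abs_nonneg _) (norm_nonneg _)
  have h4 := hq (toReal n)
  rw [norm_intCast_pi] at h4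
  have h5 : τ.im * π * (c * ‖n‖ ^ 2) ≤ τ.im * π * quad A (toReal n) := by gcongr
  have h6 := mul_le_mul_of_nonneg_left h3 (by positivity : 0 ≤ 2 * π)
  rw [h1, h2]
  linarith

lemma summable_jacobiTerm [DecidableEq ι] {A : Matrix ι ι ℝ} (hA : IsUnit A.det) (v : ι → ℝ)
    {τ : ℂ} (hτ : 0 < τ.im) (s : ℂ) : Summable (jacobiTerm A v τ s) := by
  obtain ⟨c, hc, C, hC, hb⟩ := norm_jacobiTerm_le hA v
  exact Summable.of_norm_bounded
    (summable_exp_neg_mul_norm_sq_add (by positivity : 0 < τ.im * c) (‖s‖ * C))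
    fun n ↦ hb τ s n hτ.le

lemma continuous_tsum_cexp_quad_add [DecidableEq ι] {A : Matrix ι ι ℝ} (hA : IsUnit A.det)
    {τ : ℂ} (hτ : 0 < τ.im) :
    Continuous fun x : ι → ℝ ↦ ∑' n : ι → ℤ, cexp (π * I * τ * quad A (x + toReal n)) := by
  obtain ⟨c, hc, hq⟩ := exists_mul_norm_sq_le_quad hA
  rw [continuous_iff_continuousAt]
  intro x₀
  set M := ‖x₀‖ + 1
  have hM : ContinuousOn
      (fun x : ι → ℝ ↦ ∑' n : ι → ℤ, cexp (π * I * τ * quad A (x + toReal n)))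
      (Metric.ball 0 M) := by
    refine continuousOn_tsum (u := fun n ↦ rexp (-(π * τ.im * c) * ‖n‖ ^ 2 +
      (π * τ.im * c * (2 * M)) * ‖n‖)) (fun n ↦ ?_)
      (summable_exp_neg_mul_norm_sq_add (by positivity) _) ?_
    · have := continuous_quad A
      exact Continuous.continuousOn (by fun_prop)
    · intro n x hx
      rw [mem_ball_zero_iff] at hx
      rw [norm_cexp_pi_I_mul]
      apply Real.exp_le_exp.mpr
      have h1 := hq (x + toReal n)
      have h2 : |‖n‖ - ‖x‖| ≤ ‖x + toReal n‖ := by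
        have := abs_norm_sub_norm_le (toReal n) (-x)
        rwa [norm_intCast_pi, norm_neg, sub_neg_eq_add, add_comm] at this
      have h3 : (‖n‖ - ‖x‖) ^ 2 ≤ ‖x + toReal n‖ ^ 2 := by
        rw [← sq_abs]
        gcongr
      have h4 : ‖n‖ * ‖x‖ ≤ ‖n‖ * M := by gcongr
      have h5 : ‖n‖ ^ 2 - 2 * M * ‖n‖ ≤ ‖x + toReal n‖ ^ 2 := by nlinarith [sq_nonneg ‖x‖]
      have h6 : π * τ.im * (c * (‖n‖ ^ 2 - 2 * M * ‖n‖)) ≤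
          π * τ.im * quad A (x + toReal n) :=
        mul_le_mul_of_nonneg_left ((mul_le_mul_of_nonneg_left h5 hc.le).trans h1) (by positivity)
      linarith
  exact hM.continuousAt (Metric.isOpen_ball.mem_nhds (by simp [M]))

theorem jacobi_inversion [DecidableEq ι] {A : Matrix ι ι ℝ} {G : Matrix ι ι ℤ}
    (hG : IsUnit G) (hdet : |A.det| = 1) (hAG : Aᵀ * A = G.map (Int.cast : ℤ → ℝ))
    (v : ι → ℝ) {τ : ℂ} (hτ : 0 < τ.im) (s : ℝ) :
    cexp (π * I * τ * (s ^ 2 * quad A v)) * ∑' n, jacobiTerm A v τ (τ * s) n =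
      (I / τ) ^ (Fintype.card ι / 2 : ℂ) * ∑' n, jacobiTerm A v (-1 / τ) s n := by
  have hA : IsUnit A.det := by
    rw [isUnit_iff_ne_zero]
    intro h
    simp [h] at hdet
  have hτ' : 0 < (-1 / τ).im := by
    rw [neg_div, one_div, neg_im, inv_im]
    have : 0 < normSq τ := normSq_pos.mpr (by rintro rfl; simp at hτ)
    rw [neg_div, neg_neg]
    positivity
  let e : (ι → ℤ) ≃ (ι → ℤ) :=
    { toFun := fun n ↦ G *ᵥ n
      invFun := fun n ↦ G⁻¹ *ᵥ n
      left_inv := fun n ↦ by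
        simp [Matrix.mulVec_mulVec, Matrix.nonsing_inv_mul G ((Matrix.isUnit_iff_isUnit_det G).mp hG)]
      right_inv := fun n ↦ by
        simp [Matrix.mulVec_mulVec, Matrix.mul_nonsing_inv G ((Matrix.isUnit_iff_isUnit_det G).mp hG)] }
  have he : ∀ n x, ∑ i, (e n i : ℂ) * (x i : ℝ) = bil A (toReal n) x := by
    intro n x
    have h1 : toReal (e n) = (Aᵀ * A) *ᵥ toReal n := by
      rw [hAG]
      funext i
      simp [e, toReal, Matrix.mulVec, dotProduct]
    have h2 : ∑ i, toReal (e n) i * x i = bil A (toReal n) x := by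
      change toReal (e n) ⬝ᵥ x = (A *ᵥ toReal n) ⬝ᵥ (A *ᵥ x)
      rw [h1, ← Matrix.mulVec_mulVec, Matrix.mulVec_transpose, ← Matrix.dotProduct_mulVec]
    rw [← h2]
    push_cast
    rfl
  set g : (ι → ℝ) → ℂ := fun x ↦ cexp (π * I * τ * quad A x)
  have hF : ∀ n, (∫ y, cexp (-(2 * π * I * ∑ i, (e n i : ℂ) * y i)) * g y) =
      (I / τ) ^ (Fintype.card ι / 2 : ℂ) * jacobiTerm A v (-1 / τ) 0 n := by
    intro n
    simp only [he, g]
    rw [integral_cexp_bil_mul_cexp_quad hdet hτ, jacobiTerm]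
    congr 2
    ring
  have key := tsum_translate_eq_tsum_fourier (integrable_cexp_quad hdet hτ)
    (continuous_tsum_cexp_quad_add hA hτ) (by
      rw [← e.summable_iff]
      refine ((summable_jacobiTerm hA v hτ' 0).mul_left
        ((I / τ) ^ (Fintype.card ι / 2 : ℂ))).congr fun n ↦ ?_
      exact (hF n).symm) (s • v)
  conv_rhs at key => rw [← e.tsum_eq]
  rw [← tsum_mul_left, ← tsum_mul_left]
  convert key using 1
  · refine tsum_congr fun n ↦ ?_
    change _ = cexp (π * I * τ * quad A (s • v + toReal n))
    rw [jacobiTerm, ← Complex.exp_add, quad_add, quad_smul, bil_smul_left, bil_comm]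
    congr 1
    push_cast
    ring
  · refine tsum_congr fun n ↦ ?_
    have h1 : ∑ i, (e n i : ℂ) * ((s • v) i : ℝ) = s * bil A (toReal n) v := by
      rw [he, bil_comm, bil_smul_left, bil_comm]
      push_cast
      rfl
    rw [h1]
    change _ = (∫ y, cexp (-(2 * π * I * ∑ i, (e n i : ℂ) * y i)) * g y) * _
    rw [hF, mul_assoc, jacobiTerm, jacobiTerm, ← Complex.exp_add]
    congr 2
    ring

end Inversion

section SecondDerivative

open Set Complex Matrix
open scoped Real

variable {ι : Type*} [Fintype ι]

/-- The theta series of the lattice `A ℤ^ι` in the direction `v`, weighted by the `k`-th power of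
the inner product with `v`. -/
noncomputable def jacobiSum (A : Matrix ι ι ℝ) (v : ι → ℝ) (k : ℕ) (τ s : ℂ) : ℂ :=
  ∑' n, (bil A (toReal n) v : ℂ) ^ k * jacobiTerm A v τ s n

lemma norm_bil_pow_mul_jacobiTerm_le [DecidableEq ι] {A : Matrix ι ι ℝ} (hA : IsUnit A.det)
    (v : ι → ℝ) (k : ℕ) :
    ∃ c > 0, ∃ C > 0, ∀ (τ s : ℂ) (n : ι → ℤ), 0 ≤ τ.im →
      ‖(bil A (toReal n) v : ℂ) ^ k * jacobiTerm A v τ s n‖ ≤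
        k.factorial * rexp (-(τ.im * c) * ‖n‖ ^ 2 + (‖s‖ + 1) * C * ‖n‖) := by
  obtain ⟨c, hc, C, hC, hb⟩ := norm_jacobiTerm_le hA v
  obtain ⟨D, hD, hd⟩ := exists_abs_bil_le A v
  refine ⟨c, hc, max C D, lt_max_of_lt_left hC, fun τ s n hτ ↦ ?_⟩
  rw [norm_mul, norm_pow, Complex.norm_real, Real.norm_eq_abs]
  have h1 : |bil A (toReal n) v| ^ k ≤ k.factorial * rexp (max C D * ‖n‖) := by
    have h2 := Real.pow_div_factorial_le_exp _ (abs_nonneg (bil A (toReal n) v)) k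
    rw [div_le_iff₀' (by positivity)] at h2
    refine h2.trans ?_
    have h3 := hd (toReal n)
    rw [norm_intCast_pi] at h3
    gcongr
    exact h3.trans (by gcongr; exact le_max_right _ _)
  calc _ ≤ (k.factorial * rexp (max C D * ‖n‖)) *
        rexp (-(τ.im * c) * ‖n‖ ^ 2 + ‖s‖ * C * ‖n‖) :=
        mul_le_mul h1 (hb τ s n hτ) (norm_nonneg _) (by positivity)
    _ ≤ (k.factorial * rexp (max C D * ‖n‖)) *
        rexp (-(τ.im * c) * ‖n‖ ^ 2 + ‖s‖ * max C D * ‖n‖) := by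
        gcongr
        exact le_max_left _ _
    _ = _ := by
        rw [mul_assoc, ← Real.exp_add]
        ring_nf

lemma summable_bil_pow_mul_jacobiTerm [DecidableEq ι] {A : Matrix ι ι ℝ} (hA : IsUnit A.det)
    (v : ι → ℝ) (k : ℕ) {τ : ℂ} (hτ : 0 < τ.im) (s : ℂ) :
    Summable fun n ↦ (bil A (toReal n) v : ℂ) ^ k * jacobiTerm A v τ s n := by
  obtain ⟨c, hc, C, hC, hb⟩ := norm_bil_pow_mul_jacobiTerm_le hA v k
  exact Summable.of_norm_bounded
    ((summable_exp_neg_mul_norm_sq_add (by positivity : 0 < τ.im * c) ((‖s‖ + 1) * C)).mul_left _)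
    fun n ↦ hb τ s n hτ.le

lemma hasDerivAt_jacobiTerm (A : Matrix ι ι ℝ) (v : ι → ℝ) (τ s : ℂ) (n : ι → ℤ) :
    HasDerivAt (fun s ↦ jacobiTerm A v τ s n)
      (2 * π * I * (bil A (toReal n) v * jacobiTerm A v τ s n)) s := by
  unfold jacobiTerm
  have h1 : HasDerivAt (fun s : ℂ ↦ π * I * τ * quad A (toReal n) +
      2 * π * I * s * bil A (toReal n) v) (2 * π * I * 1 * bil A (toReal n) v) s :=
    (((hasDerivAt_id s).const_mul (2 * π * I : ℂ)).mul_const _).const_add _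
  refine h1.cexp.congr_deriv ?_
  ring

lemma hasDerivAt_jacobiSum [DecidableEq ι] {A : Matrix ι ι ℝ} (hA : IsUnit A.det)
    (v : ι → ℝ) (k : ℕ) {τ : ℂ} (hτ : 0 < τ.im) (s : ℂ) :
    HasDerivAt (jacobiSum A v k τ) (2 * π * I * jacobiSum A v (k + 1) τ s) s := by
  obtain ⟨c, hc, C, hC, hb⟩ := norm_bil_pow_mul_jacobiTerm_le hA v k
  set U : Set ℂ := Metric.ball 0 (‖s‖ + 1)
  have hs : s ∈ U := by simp [U]
  have hd : ∀ n w, HasDerivAt (fun w ↦ (bil A (toReal n) v : ℂ) ^ k * jacobiTerm A v τ w n)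
      ((bil A (toReal n) v : ℂ) ^ k *
        (2 * π * I * (bil A (toReal n) v * jacobiTerm A v τ w n))) w :=
    fun n w ↦ (hasDerivAt_jacobiTerm A v τ w n).const_mul _
  have hu : Summable fun n : ι → ℤ ↦ (k.factorial : ℝ) *
      rexp (-(τ.im * c) * ‖n‖ ^ 2 + (‖s‖ + 1 + 1) * C * ‖n‖) :=
    (summable_exp_neg_mul_norm_sq_add (by positivity : 0 < τ.im * c) _).mul_left _
  have hF : ∀ (n : ι → ℤ) w, w ∈ U → ‖(bil A (toReal n) v : ℂ) ^ k * jacobiTerm A v τ w n‖ ≤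
      k.factorial * rexp (-(τ.im * c) * ‖n‖ ^ 2 + (‖s‖ + 1 + 1) * C * ‖n‖) := by
    intro n w hw
    refine (hb τ w n hτ.le).trans ?_
    have : ‖w‖ ≤ ‖s‖ + 1 := (mem_ball_zero_iff.mp hw).le
    gcongr
  have hdiff : ∀ n, DifferentiableOn ℂ
      (fun w ↦ (bil A (toReal n) v : ℂ) ^ k * jacobiTerm A v τ w n) U :=
    fun n w _ ↦ (hd n w).differentiableAt.differentiableWithinAt
  have h1 := hasSum_deriv_of_summable_norm hu hdiff Metric.isOpen_ball hF hs
  have h2 := differentiableOn_tsum_of_summable_norm hu hdiff Metric.isOpen_ball hF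
  have h3 := (h2.differentiableAt (Metric.isOpen_ball.mem_nhds hs)).hasDerivAt
  refine h3.congr_deriv ?_
  rw [← h1.tsum_eq, jacobiSum, ← tsum_mul_left]
  refine tsum_congr fun n ↦ ?_
  rw [(hd n s).deriv]
  ring

lemma jacobiSum_neg_inv [DecidableEq ι] {A : Matrix ι ι ℝ} {G : Matrix ι ι ℤ}
    (hcard : Fintype.card ι = 24)
    (hG : IsUnit G) (hdet : |A.det| = 1) (hAG : Aᵀ * A = G.map (Int.cast : ℤ → ℝ))
    (v : ι → ℝ) {τ : ℂ} (hτ : 0 < τ.im) :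
    jacobiSum A v 2 (-1 / τ) 0 = τ ^ 14 * jacobiSum A v 2 τ 0 -
      I / (2 * π) * τ ^ 13 * quad A v * jacobiSum A v 0 τ 0 := by
  have hτ0 : τ ≠ 0 := by
    rintro rfl
    simp at hτ
  have hpi : (π : ℂ) ≠ 0 := by exact_mod_cast Real.pi_ne_zero
  have hA : IsUnit A.det := by
    rw [isUnit_iff_ne_zero]
    intro h
    simp [h] at hdet
  have hτ' : 0 < (-1 / τ).im := by
    rw [neg_div, one_div, neg_im, inv_im]
    have : 0 < normSq τ := normSq_pos.mpr hτ0
    rw [neg_div, neg_neg]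
    positivity
  set E : ℝ → ℂ := fun s ↦ cexp (π * I * τ * (s ^ 2 * quad A v))
  have hconst : (I / τ) ^ (Fintype.card ι / 2 : ℂ) = (τ ^ 12)⁻¹ := by
    have : (Fintype.card ι / 2 : ℂ) = (12 : ℕ) := by
      rw [hcard]
      norm_num
    rw [this, Complex.cpow_natCast, div_pow, show I ^ 12 = (I ^ 4) ^ 3 by ring, I_pow_four]
    simp
  have hinv : ∀ s : ℝ, E s * jacobiSum A v 0 τ (τ * s) =
      (τ ^ 12)⁻¹ * jacobiSum A v 0 (-1 / τ) s := by
    intro s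
    simpa [E, jacobiSum, hconst] using jacobi_inversion hG hdet hAG v hτ s
  have hE : ∀ s : ℝ, HasDerivAt E (E s * (π * I * τ * (2 * s * quad A v))) s := by
    intro s
    have h1 : HasDerivAt (fun s : ℂ ↦ π * I * τ * (s ^ 2 * quad A v))
        (π * I * τ * (2 * s * quad A v)) s := by
      simpa using ((hasDerivAt_pow 2 (s : ℂ)).mul_const (quad A v : ℂ)).const_mul (π * I * τ)
    exact h1.cexp.comp_ofReal
  have hJ : ∀ k (s : ℝ), HasDerivAt (fun s : ℝ ↦ jacobiSum A v k τ (τ * s))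
      (τ * (2 * π * I * jacobiSum A v (k + 1) τ (τ * s))) s := by
    intro k s
    have h1 : HasDerivAt (fun s : ℂ ↦ τ * s) τ (s : ℂ) := by
      simpa using (hasDerivAt_id (s : ℂ)).const_mul τ
    have h2 := HasDerivAt.comp (s : ℂ) (hasDerivAt_jacobiSum hA v k hτ (τ * s)) h1
    rw [mul_comm] at h2
    exact h2.comp_ofReal
  have hJ' : ∀ k (s : ℝ), HasDerivAt (fun s : ℝ ↦ jacobiSum A v k (-1 / τ) s)
      (2 * π * I * jacobiSum A v (k + 1) (-1 / τ) s) s :=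
    fun k s ↦ (hasDerivAt_jacobiSum hA v k hτ' s).comp_ofReal
  have hd1 : ∀ s : ℝ, E s * (π * I * τ * (2 * s * quad A v)) * jacobiSum A v 0 τ (τ * s) +
      E s * (τ * (2 * π * I * jacobiSum A v 1 τ (τ * s))) =
      (τ ^ 12)⁻¹ * (2 * π * I * jacobiSum A v 1 (-1 / τ) s) := by
    intro s
    have h1 := (hE s).mul (hJ 0 s)
    have h2 := (hJ' 0 s).const_mul (τ ^ 12)⁻¹
    have h3 : (E * fun s : ℝ ↦ jacobiSum A v 0 τ (τ * s)) =
        fun s : ℝ ↦ (τ ^ 12)⁻¹ * jacobiSum A v 0 (-1 / τ) s := funext hinv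
    rw [h3] at h1
    exact h1.unique h2
  have hd2 : 2 * π * I * τ * quad A v * jacobiSum A v 0 τ 0 +
      τ * (2 * π * I * (τ * (2 * π * I * jacobiSum A v 2 τ 0))) =
      (τ ^ 12)⁻¹ * (2 * π * I * (2 * π * I * jacobiSum A v 2 (-1 / τ) 0)) := by
    have hlin : HasDerivAt (fun s : ℝ ↦ π * I * τ * (2 * (s : ℂ) * quad A v))
        (π * I * τ * (2 * quad A v)) 0 := by
      have := ((((hasDerivAt_id (0 : ℂ)).const_mul 2).mul_const (quad A v : ℂ)).const_mul
        (π * I * τ))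
      rw [mul_one] at this
      exact HasDerivAt.comp_ofReal (z := 0) (by simpa using this)
    have h1 := (((hE 0).mul hlin).mul (hJ 0 0)).add
      ((hE 0).mul (((hJ 1 0).const_mul (2 * π * I)).const_mul τ))
    have h2 := ((hJ' 1 0).const_mul (2 * π * I)).const_mul (τ ^ 12)⁻¹
    have h3 := h1.congr_of_eventuallyEq (f₁ := fun s : ℝ ↦
      (τ ^ 12)⁻¹ * (2 * π * I * jacobiSum A v 1 (-1 / τ) s))
      (Filter.Eventually.of_forall fun s ↦ (hd1 s).symm)
    have h4 := h3.unique h2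
    have hE0 : E 0 = 1 := by simp [E]
    simp only [Pi.mul_apply, hE0, ofReal_zero, mul_zero, zero_mul, add_zero, one_mul,
      zero_add] at h4
    rw [← h4]
    ring
  have h12 : jacobiSum A v 2 (-1 / τ) 0 * (2 * π * I) ^ 2 = τ ^ 12 *
      (2 * π * I * τ * quad A v * jacobiSum A v 0 τ 0 +
      τ * (2 * π * I * (τ * (2 * π * I * jacobiSum A v 2 τ 0)))) := by
    rw [hd2]
    field_simp
  have h2pi : (2 * π * I : ℂ) ^ 2 ≠ 0 := by simp [hpi]
  apply mul_right_cancel₀ h2pi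
  rw [h12]
  field_simp
  linear_combination (quad A v * jacobiSum A v 0 τ 0) * I_sq

end SecondDerivative

section CuspForm

open Complex UpperHalfPlane MatrixGroups ModularForm SlashInvariantForm

/-- A level one cusp form of weight `14` vanishes. -/
theorem eq_zero_of_weight_fourteen {F : ℂ → ℂ} (hol : DifferentiableOn ℂ F {z | 0 < z.im})
    (hS : ∀ τ : ℂ, 0 < τ.im → F (-1 / τ) = τ ^ 14 * F τ)
    (hT : ∀ τ : ℂ, 0 < τ.im → F (1 + τ) = F τ)
    (h0 : ∀ ε > 0, ∃ y : ℝ, ∀ τ : ℂ, 0 < τ.im → y ≤ τ.im → ‖F τ‖ ≤ ε) {τ : ℂ} (hτ : 0 < τ.im) :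
    F τ = 0 := by
  let f : ℍ → ℂ := fun z ↦ F z
  have hfS : f ∣[(14 : ℤ)] ModularGroup.S = f := by
    ext z
    rw [slash_S_apply]
    have h1 : f (.mk _ z.im_inv_neg_coe_pos) = (z : ℂ) ^ 14 * F z := by
      rw [← hS z z.im_pos]
      change F (-(z : ℂ))⁻¹ = _
      rw [inv_neg, neg_div, one_div]
    rw [h1]
    have hz : (z : ℂ) ≠ 0 := ne_zero z
    change (z : ℂ) ^ 14 * F z * (z : ℂ) ^ (-14 : ℤ) = F z
    rw [mul_right_comm, zpow_neg]
    have : (z : ℂ) ^ (14 : ℤ) = (z : ℂ) ^ 14 := by norm_cast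
    rw [this, mul_inv_cancel₀ (pow_ne_zero _ hz), one_mul]
  have hfT : f ∣[(14 : ℤ)] ModularGroup.T = f := by
    ext z
    rw [SL_slash_apply, modular_T_smul, ModularGroup.denom_apply]
    simpa [f, ModularGroup.T] using hT z z.im_pos
  have hinv := slash_action_generators_SL2Z hfS hfT
  let g : CuspForm 𝒮ℒ 14 :=
    { toFun := f
      slash_action_eq' := by
        rintro _ ⟨γ, rfl⟩
        exact hinv γ
      holo' := by
        rw [UpperHalfPlane.mdifferentiable_iff]
        refine hol.congr fun z hz ↦ ?_
        simp [f, ofComplex_apply_of_im_pos hz]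
      zero_at_cusps' := by
        intro c hc
        rw [Subgroup.IsArithmetic.isCusp_iff_isCusp_SL2Z] at hc
        rw [OnePoint.isZeroAt_iff_forall_SL2Z hc]
        intro γ _
        rw [hinv, isZeroAtImInfty_iff]
        intro ε hε
        obtain ⟨y, hy⟩ := h0 ε hε
        exact ⟨y, fun z hz ↦ hy z z.im_pos hz⟩ }
  have hg : CuspForm.discriminantEquiv g = 0 :=
    rank_zero_iff_forall_zero.mp ModularForm.levelOne_weight_two_rank_zero _
  have hg0 : g = 0 := CuspForm.discriminantEquiv.map_eq_zero_iff.mp hg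
  exact congrArg (fun g : CuspForm 𝒮ℒ 14 ↦ g ⟨τ, hτ⟩) hg0

end CuspForm

section Design

open Complex Matrix Filter
open scoped Real Topology

variable {ι : Type*} [Fintype ι]

/-- The sum over the lattice of `A` of `quad A w * (n, v)² - quad A v * (n, w)²` weighted by
`exp(πiτ (n, n))`, which is the theta series of a harmonic polynomial up to a scalar. -/
noncomputable def harmonicTheta (A : Matrix ι ι ℝ) (v w : ι → ℝ) (τ : ℂ) : ℂ :=
  quad A w * jacobiSum A v 2 τ 0 - quad A v * jacobiSum A w 2 τ 0

/-- The polynomial weight appearing in `harmonicTheta`. -/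
noncomputable def harmonicWeight (A : Matrix ι ι ℝ) (v w x : ι → ℝ) : ℝ :=
  quad A w * bil A x v ^ 2 - quad A v * bil A x w ^ 2

lemma jacobiTerm_zero (A : Matrix ι ι ℝ) (v : ι → ℝ) (τ : ℂ) (n : ι → ℤ) :
    jacobiTerm A v τ 0 n = cexp (π * I * τ * quad A (toReal n)) := by
  simp [jacobiTerm]

lemma hasSum_harmonicTheta [DecidableEq ι] {A : Matrix ι ι ℝ} (hA : IsUnit A.det)
    (v w : ι → ℝ) {τ : ℂ} (hτ : 0 < τ.im) :
    HasSum (fun n ↦ (harmonicWeight A v w (toReal n) : ℂ) *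
      cexp (π * I * τ * quad A (toReal n))) (harmonicTheta A v w τ) := by
  have h1 := (summable_bil_pow_mul_jacobiTerm hA v 2 hτ 0).hasSum.mul_left (quad A w : ℂ)
  have h2 := (summable_bil_pow_mul_jacobiTerm hA w 2 hτ 0).hasSum.mul_left (quad A v : ℂ)
  refine (h1.sub h2).congr_fun fun n ↦ ?_
  simp only [jacobiTerm_zero, harmonicWeight]
  push_cast
  ring

lemma differentiableOn_jacobiSum [DecidableEq ι] {A : Matrix ι ι ℝ} (hA : IsUnit A.det)
    (v : ι → ℝ) (k : ℕ) (s : ℂ) :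
    DifferentiableOn ℂ (fun τ ↦ jacobiSum A v k τ s) {τ | 0 < τ.im} := by
  obtain ⟨c, hc, C, hC, hb⟩ := norm_bil_pow_mul_jacobiTerm_le hA v k
  intro τ hτ
  have hτ : 0 < τ.im := hτ
  set U : Set ℂ := {z | τ.im / 2 < z.im}
  have hU : IsOpen U := isOpen_lt continuous_const Complex.continuous_im
  have hτU : τ ∈ U := by
    change τ.im / 2 < τ.im
    linarith
  have h := differentiableOn_tsum_of_summable_norm
    (F := fun n τ ↦ (bil A (toReal n) v : ℂ) ^ k * jacobiTerm A v τ s n)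
    ((summable_exp_neg_mul_norm_sq_add (ι := ι) (by positivity : 0 < τ.im / 2 * c)
      ((‖s‖ + 1) * C)).mul_left (k.factorial : ℝ)) (fun n ↦ ?_) hU (fun n z hz ↦ ?_)
  · exact (h.differentiableAt (hU.mem_nhds hτU)).differentiableWithinAt
  · unfold jacobiTerm
    fun_prop
  · have hz : τ.im / 2 < z.im := hz
    refine (hb z s n (by linarith)).trans ?_
    gcongr

lemma harmonicTheta_neg_inv [DecidableEq ι] {A : Matrix ι ι ℝ} {G : Matrix ι ι ℤ}
    (hcard : Fintype.card ι = 24)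
    (hG : IsUnit G) (hdet : |A.det| = 1) (hAG : Aᵀ * A = G.map (Int.cast : ℤ → ℝ))
    (v w : ι → ℝ) {τ : ℂ} (hτ : 0 < τ.im) :
    harmonicTheta A v w (-1 / τ) = τ ^ 14 * harmonicTheta A v w τ := by
  have h : jacobiSum A v 0 τ 0 = jacobiSum A w 0 τ 0 := by
    simp [jacobiSum, jacobiTerm_zero]
  rw [harmonicTheta, harmonicTheta, jacobiSum_neg_inv hcard hG hdet hAG v hτ,
    jacobiSum_neg_inv hcard hG hdet hAG w hτ, h]
  ring

lemma two_le_quad [DecidableEq ι] {A : Matrix ι ι ℝ} (hA : IsUnit A.det)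
    (heven : ∀ n : ι → ℤ, ∃ m : ℤ, quad A (toReal n) = 2 * m) {n : ι → ℤ} (hn : n ≠ 0) :
    2 ≤ quad A (toReal n) := by
  obtain ⟨c, hc, hq⟩ := exists_mul_norm_sq_le_quad hA
  have h1 := hq (toReal n)
  rw [norm_intCast_pi] at h1
  have h2 : 0 < c * ‖n‖ ^ 2 := by
    have := norm_pos_iff.mpr hn
    positivity
  obtain ⟨m, hm⟩ := heven n
  rw [hm] at h1 ⊢
  have : 0 < m := by
    by_contra! hle
    have : (m : ℝ) ≤ 0 := by exact_mod_cast hle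
    linarith
  have : (1 : ℝ) ≤ m := by exact_mod_cast this
  linarith

lemma harmonicWeight_zero (A : Matrix ι ι ℝ) (v w : ι → ℝ) :
    harmonicWeight A v w (toReal 0) = 0 := by
  have : (toReal 0 : ι → ℝ) = 0 := by
    funext i
    simp
  simp [harmonicWeight, bil, this]

lemma norm_harmonicTheta_term_le [DecidableEq ι] {A : Matrix ι ι ℝ} (hA : IsUnit A.det)
    (heven : ∀ n : ι → ℤ, ∃ m : ℤ, quad A (toReal n) = 2 * m) (v w : ι → ℝ) {τ : ℂ}
    (hτ : 1 ≤ τ.im) (n : ι → ℤ) :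
    ‖(harmonicWeight A v w (toReal n) : ℂ) * cexp (π * I * τ * quad A (toReal n))‖ ≤
      ‖(harmonicWeight A v w (toReal n) : ℂ) * cexp (π * I * I * quad A (toReal n))‖ *
        rexp (-(2 * π * (τ.im - 1))) := by
  by_cases hn : n = 0
  · subst hn
    rw [harmonicWeight_zero]
    simp
  rw [norm_mul, norm_mul, norm_cexp_pi_I_mul, norm_cexp_pi_I_mul, mul_assoc ‖_‖, ← Real.exp_add]
  refine mul_le_mul_of_nonneg_left (Real.exp_le_exp.mpr ?_) (norm_nonneg _)
  have h1 := two_le_quad hA heven hn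
  have h2 : π * (τ.im - 1) * 2 ≤ π * (τ.im - 1) * quad A (toReal n) :=
    mul_le_mul_of_nonneg_left h1 (mul_nonneg Real.pi_pos.le (by linarith))
  rw [I_im]
  linarith

lemma norm_harmonicTheta_le [DecidableEq ι] {A : Matrix ι ι ℝ} (hA : IsUnit A.det)
    (heven : ∀ n : ι → ℤ, ∃ m : ℤ, quad A (toReal n) = 2 * m) (v w : ι → ℝ) :
    ∃ M, ∀ τ : ℂ, 1 ≤ τ.im → ‖harmonicTheta A v w τ‖ ≤ M * rexp (-(2 * π * (τ.im - 1))) := by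
  have hI : 0 < I.im := by simp
  refine ⟨∑' n, ‖(harmonicWeight A v w (toReal n) : ℂ) *
    cexp (π * I * I * quad A (toReal n))‖, fun τ hτ ↦ ?_⟩
  have h := hasSum_harmonicTheta hA v w (τ := τ) (by linarith)
  rw [← h.tsum_eq]
  refine tsum_of_norm_bounded ?_ (norm_harmonicTheta_term_le hA heven v w hτ)
  exact (hasSum_harmonicTheta hA v w hI).summable.norm.hasSum.mul_right _

theorem harmonicTheta_eq_zero [DecidableEq ι] {A : Matrix ι ι ℝ} {G : Matrix ι ι ℤ}
    (hcard : Fintype.card ι = 24)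
    (hG : IsUnit G) (hdet : |A.det| = 1) (hAG : Aᵀ * A = G.map (Int.cast : ℤ → ℝ))
    (heven : ∀ n : ι → ℤ, ∃ m : ℤ, quad A (toReal n) = 2 * m)
    (v w : ι → ℝ) {τ : ℂ} (hτ : 0 < τ.im) :
    harmonicTheta A v w τ = 0 := by
  have hA : IsUnit A.det := by
    rw [isUnit_iff_ne_zero]
    intro h
    simp [h] at hdet
  refine eq_zero_of_weight_fourteen (F := harmonicTheta A v w) ?_
    (fun τ hτ ↦ harmonicTheta_neg_inv hcard hG hdet hAG v w hτ) (fun τ hτ ↦ ?_) (fun ε hε ↦ ?_) hτ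
  · exact ((differentiableOn_jacobiSum hA v 2 0).const_mul _).sub
      ((differentiableOn_jacobiSum hA w 2 0).const_mul _)
  · rw [← (hasSum_harmonicTheta hA v w hτ).tsum_eq,
      ← (hasSum_harmonicTheta hA v w (τ := 1 + τ) (by simpa using hτ)).tsum_eq]
    refine tsum_congr fun n ↦ ?_
    obtain ⟨m, hm⟩ := heven n
    rw [hm]
    congr 1
    push_cast
    rw [show (π * I * (1 + τ) * (2 * m) : ℂ) = π * I * τ * (2 * m) + m * (2 * π * I) by ring,
      Complex.exp_add, Complex.exp_int_mul_two_pi_mul_I, mul_one]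
  · obtain ⟨M, hM⟩ := norm_harmonicTheta_le hA heven v w
    have hlim : Tendsto (fun y : ℝ ↦ M * rexp (-(2 * π * (y - 1)))) atTop (𝓝 (M * 0)) := by
      refine (Real.tendsto_exp_neg_atTop_nhds_zero.comp ?_).const_mul M
      exact (tendsto_atTop_add_const_right _ (-1) tendsto_id).const_mul_atTop (by positivity)
    rw [mul_zero] at hlim
    obtain ⟨y, hy⟩ := eventually_atTop.mp
      ((hlim.eventually (gt_mem_nhds hε)).and (eventually_ge_atTop 1))
    exact ⟨y, fun τ _ hyτ ↦ (hM τ (hy _ hyτ).2).trans (hy _ hyτ).1.le⟩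

lemma finite_quad_eq_two [DecidableEq ι] {A : Matrix ι ι ℝ} (hA : IsUnit A.det) :
    {n : ι → ℤ | quad A (toReal n) = 2}.Finite := by
  have hI : 0 < I.im := by simp
  have h := (summable_jacobiTerm hA 0 hI 0).norm.tendsto_cofinite_zero
  have h2 := h.eventually (gt_mem_nhds (Real.exp_pos (-(π * 2))))
  refine Set.Finite.subset h2 fun n hn ↦ ?_
  have hn : quad A (toReal n) = 2 := hn
  change ¬ (‖jacobiTerm A 0 I 0 n‖ < _)
  rw [jacobiTerm_zero, norm_cexp_pi_I_mul, hn, I_im]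
  simp

theorem sum_harmonicWeight_eq_zero [DecidableEq ι] {A : Matrix ι ι ℝ} {G : Matrix ι ι ℤ}
    (hcard : Fintype.card ι = 24)
    (hG : IsUnit G) (hdet : |A.det| = 1) (hAG : Aᵀ * A = G.map (Int.cast : ℤ → ℝ))
    (heven : ∀ n : ι → ℤ, ∃ m : ℤ, quad A (toReal n) = 2 * m)
    (v w : ι → ℝ) {S : Finset (ι → ℤ)} (hS : ∀ n, n ∈ S ↔ quad A (toReal n) = 2) :
    ∑ n ∈ S, harmonicWeight A v w (toReal n) = 0 := by
  have hA : IsUnit A.det := by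
    rw [isUnit_iff_ne_zero]
    intro h
    simp [h] at hdet
  have hI : 0 < I.im := by simp
  set P : (ι → ℤ) → ℂ := fun n ↦ (harmonicWeight A v w (toReal n) : ℂ)
  let t : ℝ → (ι → ℤ) → ℂ := fun y n ↦
    P n * cexp (π * I * (y * I : ℂ) * quad A (toReal n)) * rexp (2 * π * (y - 1))
  have hyI : ∀ y : ℝ, (y * I : ℂ).im = y := fun y ↦ by simp
  have ht : ∀ y : ℝ, 0 < y → ∑' n, t y n = 0 := by
    intro y hy
    have hy' : 0 < (y * I : ℂ).im := by rwa [hyI]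
    have := (hasSum_harmonicTheta hA v w hy').mul_right (rexp (2 * π * (y - 1)) : ℂ)
    rw [harmonicTheta_eq_zero hcard hG hdet hAG heven v w hy', zero_mul] at this
    exact this.tsum_eq
  let a : (ι → ℤ) → ℂ := fun n ↦ if n ∈ S then P n * cexp (-(2 * π)) else 0
  have hlim : Tendsto (fun y ↦ ∑' n, t y n) atTop (𝓝 (∑' n, a n)) := by
    refine tendsto_tsum_of_dominated_convergence
      (hasSum_harmonicTheta hA v w hI).summable.norm (fun n ↦ ?_) ?_
    · have hform : ∀ y : ℝ, t y n =
          P n * (rexp (-(2 * π) + π * (2 - quad A (toReal n)) * y) : ℝ) := by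
        intro y
        simp only [t]
        rw [mul_assoc]
        congr 1
        push_cast
        rw [← Complex.exp_add]
        congr 1
        linear_combination (π * y * quad A (toReal n)) * I_sq
      by_cases hn : n ∈ S
      · simp only [hform, (hS n).mp hn, a, if_pos hn]
        simp
      · simp only [hform, a, if_neg hn]
        by_cases hn0 : n = 0
        · have : P n = 0 := by
            simp only [P, hn0, harmonicWeight_zero, ofReal_zero]
          simp [this]
        have h1 := two_le_quad hA heven hn0
        have h2 : 2 < quad A (toReal n) :=
          lt_of_le_of_ne h1 fun h ↦ hn ((hS n).mpr h.symm)
        rw [← mul_zero (P n)]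
        refine Tendsto.const_mul _ ?_
        rw [← ofReal_zero]
        refine (continuous_ofReal.tendsto 0).comp (Real.tendsto_exp_atBot.comp ?_)
        refine tendsto_atBot_add_const_left _ _ (tendsto_id.const_mul_atTop_of_neg ?_)
        exact mul_neg_of_pos_of_neg Real.pi_pos (by linarith)
    · filter_upwards [eventually_ge_atTop 1] with y hy n
      have h1 := norm_harmonicTheta_term_le hA heven v w (τ := y * I) (by rwa [hyI]) n
      rw [hyI] at h1
      simp only [t]
      rw [norm_mul, Complex.norm_real, Real.norm_eq_abs, abs_of_pos (Real.exp_pos _)]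
      refine (mul_le_mul_of_nonneg_right h1 (Real.exp_pos _).le).trans ?_
      rw [mul_assoc, ← Real.exp_add, neg_add_cancel, Real.exp_zero, mul_one]
  have h0 : ∑' n, a n = 0 := by
    refine tendsto_nhds_unique hlim ?_
    refine tendsto_const_nhds.congr' ?_
    filter_upwards [eventually_gt_atTop 0] with y hy
    exact (ht y hy).symm
  rw [tsum_eq_sum (s := S) (fun n hn ↦ by simp [a, hn]),
    Finset.sum_congr rfl (fun n hn ↦ if_pos hn), ← Finset.sum_mul] at h0
  have h3 := (mul_eq_zero.mp h0).resolve_right (Complex.exp_ne_zero _)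
  simp only [P] at h3
  exact_mod_cast h3

end Design

section Lattice

open Matrix Module

variable {V : Type*} [AddCommGroup V] [Module ℚ V]

/-- `L` is an even unimodular positive definite lattice of rank `24` in the quadratic space
`(V, B)`. -/
structure IsNiemeier (L : Submodule ℤ V) (B : V →ₗ[ℚ] V →ₗ[ℚ] ℚ) : Prop where
  fg : L.FG
  span_eq : Submodule.span ℚ (L : Set V) = ⊤
  rank_eq : Module.finrank ℚ V = 24
  symm : ∀ x y : V, B x y = B y x
  int : ∀ x ∈ L, ∀ y ∈ L, ∃ n : ℤ, B x y = (n : ℚ)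
  pos : ∀ x ∈ L, x ≠ 0 → 0 < B x x
  even : ∀ x ∈ L, ∃ n : ℤ, B x x = 2 * (n : ℚ)
  unimod : ∀ v : V, (∀ y ∈ L, ∃ n : ℤ, B v y = (n : ℚ)) → v ∈ L

variable {L : Submodule ℤ V} {B : V →ₗ[ℚ] V →ₗ[ℚ] ℚ}

namespace IsNiemeier

lemma exists_smul_mem (hN : IsNiemeier L B) (x : V) : ∃ N : ℤ, N ≠ 0 ∧ N • x ∈ L := by
  have hx : x ∈ Submodule.span ℚ (L : Set V) := by
    rw [hN.span_eq]
    trivial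
  induction hx using Submodule.span_induction with
  | mem x hx => exact ⟨1, one_ne_zero, by simpa using hx⟩
  | zero => exact ⟨1, one_ne_zero, by simp⟩
  | add x y _ _ hx hy =>
    obtain ⟨M, hM, hMx⟩ := hx
    obtain ⟨N, hN, hNy⟩ := hy
    refine ⟨M * N, mul_ne_zero hM hN, ?_⟩
    rw [smul_add]
    refine L.add_mem ?_ ?_
    · rw [mul_comm, mul_smul]
      exact L.smul_mem _ hMx
    · rw [mul_smul]
      exact L.smul_mem _ hNy
  | smul a x _ hx =>
    obtain ⟨M, hM, hMx⟩ := hx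
    refine ⟨a.den * M, mul_ne_zero (by exact_mod_cast a.den_nz) hM, ?_⟩
    have : ((a.den : ℤ) * M) • a • x = a.num • (M • x) := by
      simp only [← Int.cast_smul_eq_zsmul ℚ, smul_smul]
      congr 1
      push_cast
      rw [mul_right_comm, Rat.den_mul_eq_num]
    rw [this]
    exact L.smul_mem _ hMx

lemma pos_of_ne_zero (hN : IsNiemeier L B) {x : V} (hx : x ≠ 0) : 0 < B x x := by
  obtain ⟨N, hN0, hNx⟩ := hN.exists_smul_mem x
  have hN0' : (N : ℚ) ≠ 0 := by exact_mod_cast hN0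
  have h1 := hN.pos _ hNx (by
    rw [← Int.cast_smul_eq_zsmul ℚ]
    exact smul_ne_zero hN0' hx)
  rw [← Int.cast_smul_eq_zsmul ℚ] at h1
  simp only [map_smul, LinearMap.smul_apply, smul_eq_mul] at h1
  have h2 : 0 < (N : ℚ) ^ 2 := by positivity
  nlinarith

lemma nondegenerate (hN : IsNiemeier L B) : LinearMap.BilinForm.Nondegenerate B := by
  constructor
  · intro x hx
    by_contra h
    exact (hN.pos_of_ne_zero h).ne' (hx x)
  · intro x hx
    by_contra h
    exact (hN.pos_of_ne_zero h).ne' (hx x)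

lemma exists_basis (hN : IsNiemeier L B) :
    ∃ (b : Basis (Fin 24) ℚ V), (∀ i, b i ∈ L) ∧
      ∀ x ∈ L, ∃ n : Fin 24 → ℤ, x = ∑ i, n i • b i := by
  have : Module.Finite ℤ L := Module.Finite.iff_fg.mpr hN.fg
  have : IsAddTorsionFree V := .of_module_rat _
  let b₀ := Module.Free.chooseBasis ℤ L
  have hli : LinearIndependent ℚ (fun i ↦ (b₀ i : V)) := by
    rw [← LinearIndependent.iff_fractionRing ℤ ℚ]
    exact b₀.linearIndependent.map' L.subtype (Submodule.ker_subtype L)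
  have hspan : ⊤ ≤ Submodule.span ℚ (Set.range fun i ↦ (b₀ i : V)) := by
    rw [← hN.span_eq, ← Submodule.span_span_of_tower ℤ ℚ (Set.range _)]
    refine Submodule.span_mono fun x hx ↦ ?_
    have h1 : (⟨x, hx⟩ : L) ∈ Submodule.span ℤ (Set.range b₀) := by
      rw [b₀.span_eq]
      trivial
    have h2 := Submodule.mem_map_of_mem (f := L.subtype) h1
    rw [Submodule.map_span, ← Set.range_comp] at h2
    exact h2
  let b := Basis.mk hli hspan
  have hcard : Fintype.card (Module.Free.ChooseBasisIndex ℤ L) = 24 := by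
    rw [← Module.finrank_eq_card_basis b, hN.rank_eq]
  let e := Fintype.equivFinOfCardEq hcard
  refine ⟨b.reindex e, fun i ↦ ?_, fun x hx ↦ ?_⟩
  · rw [Basis.reindex_apply, Basis.mk_apply]
    exact (b₀ (e.symm i)).2
  · refine ⟨fun i ↦ b₀.repr ⟨x, hx⟩ (e.symm i), ?_⟩
    have h1 := congrArg Subtype.val (b₀.sum_repr ⟨x, hx⟩)
    simp only [Submodule.coe_sum, Submodule.coe_smul] at h1
    refine h1.symm.trans ?_
    rw [← e.symm.sum_comp]
    simp [b]

lemma exists_orthogonal_basis (hN : IsNiemeier L B) :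
    ∃ (e : Basis (Fin 24) ℚ V), ∀ i j, i ≠ j → B (e i) (e j) = 0 := by
  have : Module.Finite ℚ V := Module.finite_of_finrank_pos (by rw [hN.rank_eq]; norm_num)
  obtain ⟨v, hv⟩ := LinearMap.BilinForm.exists_orthogonal_basis (B := B) ⟨hN.symm⟩
  refine ⟨v.reindex (finCongr hN.rank_eq), fun i j hij ↦ ?_⟩
  rw [Basis.reindex_apply, Basis.reindex_apply]
  exact hv (by simpa using hij)

lemma apply_eq_sum {e : Basis (Fin 24) ℚ V} (he : ∀ i j, i ≠ j → B (e i) (e j) = 0) (x y : V) :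
    B x y = ∑ i, B (e i) (e i) * (e.repr x i * e.repr y i) := by
  conv_lhs => rw [← e.sum_repr x, ← e.sum_repr y]
  simp only [map_sum, map_smul, LinearMap.sum_apply, LinearMap.smul_apply, smul_eq_mul]
  refine Finset.sum_congr rfl fun i _ ↦ ?_
  rw [Finset.sum_eq_single i]
  · ring
  · intro j _ hj
    simp [he j i hj]
  · simp

/-- Every theta series of weight `14` of a Niemeier lattice vanishes, so the roots form a
spherical `2`-design. -/
theorem exists_finset_roots (hN : IsNiemeier L B) :
    ∃ R : Finset V, (∀ r, r ∈ R ↔ r ∈ L ∧ B r r = 2) ∧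
      ∀ v ∈ L, ∀ w ∈ L, B w w * ∑ r ∈ R, B r v ^ 2 = B v v * ∑ r ∈ R, B r w ^ 2 := by
  classical
  obtain ⟨b, hb, hbL⟩ := hN.exists_basis
  obtain ⟨e, he⟩ := hN.exists_orthogonal_basis
  have hd : ∀ i, 0 ≤ ((B (e i) (e i) : ℚ) : ℝ) := fun i ↦ by
    exact_mod_cast (hN.pos_of_ne_zero (e.ne_zero i)).le
  let A : Matrix (Fin 24) (Fin 24) ℝ :=
    .of fun i j ↦ √((B (e i) (e i) : ℚ) : ℝ) * ((e.repr (b j) i : ℚ) : ℝ)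
  choose G hG using fun i j ↦ hN.int _ (hb i) _ (hb j)
  let x : (Fin 24 → ℤ) → V := fun n ↦ ∑ j, n j • b j
  have hxL : ∀ n, x n ∈ L := fun n ↦ L.sum_mem fun j _ ↦ L.smul_mem _ (hb j)
  have hxinj : Function.Injective x := by
    intro n m h
    funext j
    have h1 : ∀ n : Fin 24 → ℤ, b.repr (x n) j = n j := by
      intro n
      simp [x, ← Int.cast_smul_eq_zsmul ℚ, Finsupp.single_apply]
    have h2 := h1 n
    rw [h, h1 m] at h2
    exact_mod_cast h2.symm
  have hAx : ∀ (n : Fin 24 → ℤ) (i : Fin 24), (A *ᵥ toReal n) i =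
      √((B (e i) (e i) : ℚ) : ℝ) * ((e.repr (x n) i : ℚ) : ℝ) := by
    intro n i
    have : e.repr (x n) i = ∑ j, e.repr (b j) i * (n j : ℚ) := by
      simp [x, ← Int.cast_smul_eq_zsmul ℚ, mul_comm]
    rw [this]
    push_cast
    rw [Finset.mul_sum, Matrix.mulVec, dotProduct]
    refine Finset.sum_congr rfl fun j _ ↦ ?_
    simp [A, toReal, mul_assoc]
  have hbil : ∀ n m, bil A (toReal n) (toReal m) = ((B (x n) (x m) : ℚ) : ℝ) := by
    intro n m
    rw [apply_eq_sum he]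
    push_cast
    refine Finset.sum_congr rfl fun i _ ↦ ?_
    rw [hAx, hAx, mul_mul_mul_comm, Real.mul_self_sqrt (hd i)]
  have hquad : ∀ n, quad A (toReal n) = ((B (x n) (x n) : ℚ) : ℝ) := by
    intro n
    rw [← hbil]
    exact Finset.sum_congr rfl fun i _ ↦ sq _
  have hAG : Aᵀ * A = (Matrix.of G).map (Int.cast : ℤ → ℝ) := by
    ext j k
    rw [Matrix.map_apply, Matrix.of_apply]
    have h1 : ((G j k : ℤ) : ℝ) = ((B (b j) (b k) : ℚ) : ℝ) := by
      rw [hG]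
      simp
    rw [h1, apply_eq_sum he, Matrix.mul_apply]
    push_cast
    refine Finset.sum_congr rfl fun i _ ↦ ?_
    simp only [A, Matrix.transpose_apply, Matrix.of_apply]
    rw [mul_mul_mul_comm, Real.mul_self_sqrt (hd i)]
  have hGunit : IsUnit (Matrix.of G) := by
    have hdual : ∀ i, ∃ n : Fin 24 → ℤ, ∀ j, ∑ k, n k * G k j = if j = i then 1 else 0 := by
      intro i
      set c := LinearMap.BilinForm.dualBasis B hN.nondegenerate b i
      have hc : ∀ j, B c (b j) = if j = i then 1 else 0 := fun j ↦
        LinearMap.BilinForm.apply_dualBasis_left hN.nondegenerate b i j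
      have hcL : c ∈ L := by
        refine hN.unimod c fun y hy ↦ ?_
        obtain ⟨m, rfl⟩ := hbL y hy
        refine ⟨m i, ?_⟩
        simp [← Int.cast_smul_eq_zsmul ℚ, hc]
      obtain ⟨n, hn⟩ := hbL c hcL
      refine ⟨n, fun j ↦ ?_⟩
      have h1 := hc j
      rw [hn] at h1
      simp only [← Int.cast_smul_eq_zsmul ℚ, map_sum, map_smul, LinearMap.sum_apply,
        LinearMap.smul_apply, hG, smul_eq_mul] at h1
      exact_mod_cast h1
    choose H hH using hdual
    have : Matrix.of H * Matrix.of G = 1 := by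
      ext i j
      rw [Matrix.mul_apply, Matrix.one_apply]
      simp only [Matrix.of_apply, hH, eq_comm]
    exact (Matrix.isUnit_iff_isUnit_det _).mpr (Matrix.isUnit_det_of_left_inverse this)
  have hdet : |A.det| = 1 := by
    have h1 := congrArg Matrix.det hAG
    rw [Matrix.det_mul, Matrix.det_transpose] at h1
    have h2 : ((Matrix.of G).map (Int.cast : ℤ → ℝ)).det = ((Matrix.of G).det : ℝ) :=
      ((Int.castRingHom ℝ).map_det _).symm
    rw [h2] at h1
    have h3 : A.det * A.det = 1 := by
      rcases Int.isUnit_iff.mp ((Matrix.isUnit_iff_isUnit_det _).mp hGunit) with h | h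
      · rw [h1, h]
        simp
      · rw [h] at h1
        push_cast at h1
        nlinarith [mul_self_nonneg A.det]
    rw [← abs_mul_self, abs_mul] at h3
    nlinarith [abs_nonneg A.det]
  have heven : ∀ n, ∃ m : ℤ, quad A (toReal n) = 2 * m := by
    intro n
    obtain ⟨m, hm⟩ := hN.even _ (hxL n)
    exact ⟨m, by rw [hquad, hm]; push_cast; rfl⟩
  have hA : IsUnit A.det := by
    rw [isUnit_iff_ne_zero]
    intro h
    simp [h] at hdet
  set S := (finite_quad_eq_two hA).toFinset
  have hS : ∀ n, n ∈ S ↔ quad A (toReal n) = 2 := fun n ↦ by simp [S]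
  refine ⟨S.image x, fun r ↦ ?_, fun v hv w hw ↦ ?_⟩
  · rw [Finset.mem_image]
    constructor
    · rintro ⟨n, hn, rfl⟩
      rw [hS, hquad] at hn
      exact ⟨hxL n, by exact_mod_cast hn⟩
    · rintro ⟨hr, hr2⟩
      obtain ⟨n, rfl⟩ := hbL r hr
      refine ⟨n, ?_, rfl⟩
      rw [hS, hquad]
      exact_mod_cast hr2
  · obtain ⟨n, rfl⟩ := hbL v hv
    obtain ⟨m, rfl⟩ := hbL w hw
    have h := sum_harmonicWeight_eq_zero (by simp) hGunit hdet hAG heven (toReal n) (toReal m) hS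
    simp only [harmonicWeight, hbil, hquad, Finset.sum_sub_distrib, ← Finset.mul_sum] at h
    rw [Finset.sum_image hxinj.injOn, Finset.sum_image hxinj.injOn]
    exact_mod_cast sub_eq_zero.mp h

/-- Venkov's identity for the roots of a Niemeier lattice. -/
theorem exists_finset_roots_sum_sq (hN : IsNiemeier L B) :
    ∃ R : Finset V, (∀ r, r ∈ R ↔ r ∈ L ∧ B r r = 2) ∧
      ∀ v, ∑ r ∈ R, B r v ^ 2 = (R.card : ℚ) / 12 * B v v := by
  obtain ⟨R, hR, hsum⟩ := hN.exists_finset_roots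
  refine ⟨R, hR, ?_⟩
  obtain ⟨b, hb, -⟩ := hN.exists_basis
  obtain ⟨e, he⟩ := hN.exists_orthogonal_basis
  set w := b 0
  have hw : 0 < B w w := hN.pos_of_ne_zero (b.ne_zero 0)
  set c := (∑ r ∈ R, B r w ^ 2) / B w w
  have hc : ∀ v, ∑ r ∈ R, B r v ^ 2 = c * B v v := by
    intro v
    obtain ⟨N, hN0, hNv⟩ := hN.exists_smul_mem v
    have hN0' : (N : ℚ) ≠ 0 := by exact_mod_cast hN0
    have h := hsum _ hNv w (hb 0)
    rw [← Int.cast_smul_eq_zsmul ℚ] at h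
    simp only [map_smul, LinearMap.smul_apply, smul_eq_mul, mul_pow, ← Finset.mul_sum] at h
    have h2 : (N : ℚ) ^ 2 * (B w w * ∑ r ∈ R, B r v ^ 2) =
        (N : ℚ) ^ 2 * (B v v * ∑ r ∈ R, B r w ^ 2) := by linear_combination h
    have h3 := mul_left_cancel₀ (pow_ne_zero 2 hN0') h2
    rw [div_mul_eq_mul_div, eq_div_iff hw.ne']
    linear_combination h3
  have hd : ∀ i, B (e i) (e i) ≠ 0 := fun i ↦ (hN.pos_of_ne_zero (e.ne_zero i)).ne'
  have hcoord : ∀ r i, B r (e i) = B (e i) (e i) * e.repr r i := by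
    intro r i
    rw [apply_eq_sum he, Finset.sum_eq_single i]
    · simp
    · intro j _ hj
      simp [hj.symm]
    · simp
  have htrace : ∑ i, (∑ r ∈ R, B r (e i) ^ 2) / B (e i) (e i) = 2 * R.card := by
    simp only [Finset.sum_div]
    rw [Finset.sum_comm]
    have : ∀ r ∈ R, ∑ i, B r (e i) ^ 2 / B (e i) (e i) = 2 := by
      intro r hr
      rw [← ((hR r).mp hr).2, apply_eq_sum he]
      refine Finset.sum_congr rfl fun i _ ↦ ?_
      rw [hcoord]
      field_simp [hd i]
    rw [Finset.sum_congr rfl this]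
    simp [mul_comm]
  simp only [hc, mul_div_assoc, div_self (hd _)] at htrace
  simp at htrace
  intro v
  rw [hc]
  congr 1
  linarith

end IsNiemeier

end Lattice

section RootSystem

open Finset

variable {V : Type*} [AddCommGroup V] [Module ℚ V]

/-- `R` is a simply laced root system, all of whose components have Coxeter number `h` and which
has full rank `24`, in the positive definite space `(V, B)`, and `f` does not vanish on `R`. -/
structure IsRootSystem (R : Finset V) (B : V →ₗ[ℚ] V →ₗ[ℚ] ℚ) (f : V →ₗ[ℚ] ℚ) (h : ℚ) :
    Prop where
  symm : ∀ x y : V, B x y = B y x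
  pos : ∀ x : V, x ≠ 0 → 0 < B x x
  norm : ∀ r ∈ R, B r r = 2
  int : ∀ r ∈ R, ∀ s ∈ R, ∃ n : ℤ, B r s = n
  neg_mem : ∀ r ∈ R, -r ∈ R
  add_mem : ∀ r ∈ R, ∀ s ∈ R, B r s = -1 → r + s ∈ R
  ne_zero : ∀ r ∈ R, f r ≠ 0
  card_eq : (R.card : ℚ) = 24 * h
  sum_sq : ∀ v, ∑ r ∈ R, B r v ^ 2 = 2 * h * B v v

/-- The positive roots. -/
def positive (R : Finset V) (f : V →ₗ[ℚ] ℚ) : Finset V := {r ∈ R | 0 < f r}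

/-- The Weyl vector. -/
def weyl (R : Finset V) (f : V →ₗ[ℚ] ℚ) : V := (2⁻¹ : ℚ) • ∑ r ∈ positive R f, r

/-- The defect of `y`, which measures the distance of `y` to the scaled Weyl vector. -/
def defect (R : Finset V) (B : V →ₗ[ℚ] V →ₗ[ℚ] ℚ) (f : V →ₗ[ℚ] ℚ) (y : V) : ℚ :=
  ∑ r ∈ positive R f, (B y r ^ 2 - B y r)

variable {R : Finset V} {B : V →ₗ[ℚ] V →ₗ[ℚ] ℚ} {f : V →ₗ[ℚ] ℚ} {h : ℚ}

lemma mem_positive {r : V} : r ∈ positive R f ↔ r ∈ R ∧ 0 < f r := by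
  rw [positive, Finset.mem_filter]

lemma weyl_apply (v : V) : B (weyl R f) v = 2⁻¹ * ∑ r ∈ positive R f, B r v := by
  simp [weyl]

namespace IsRootSystem

lemma apply_cases (hR : IsRootSystem R B f h) {r s : V} (hr : r ∈ R) (hs : s ∈ R) :
    r = s ∨ r = -s ∨ B r s = 0 ∨ B r s = 1 ∨ B r s = -1 := by
  by_cases h1 : r = s
  · exact .inl h1
  by_cases h2 : r = -s
  · exact .inr (.inl h2)
  have h3 := hR.pos _ (sub_ne_zero.mpr h1)
  have h4 := hR.pos (r + s) fun h ↦ h2 (eq_neg_of_add_eq_zero_left h)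
  simp only [map_add, map_sub, LinearMap.add_apply, LinearMap.sub_apply, hR.norm r hr,
    hR.norm s hs, hR.symm s r] at h3 h4
  obtain ⟨n, hn⟩ := hR.int r hr s hs
  rw [hn] at h3 h4 ⊢
  have h5 : (n : ℚ) < (2 : ℤ) := by
    push_cast
    linarith
  have h6 : ((-2 : ℤ) : ℚ) < n := by
    push_cast
    linarith
  rw [Int.cast_lt] at h5 h6
  have : n = 0 ∨ n = 1 ∨ n = -1 := by lia
  rcases this with rfl | rfl | rfl <;> simp

lemma sub_mem (hR : IsRootSystem R B f h) {r s : V} (hr : r ∈ R) (hs : s ∈ R) (hrs : B r s = 1) :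
    r - s ∈ R := by
  rw [sub_eq_add_neg]
  exact hR.add_mem r hr _ (hR.neg_mem s hs) (by simp [hrs])

lemma sum_even (hR : IsRootSystem R B f h) {F : V → ℚ} (hF : ∀ r, F (-r) = F r) :
    ∑ r ∈ R, F r = 2 * ∑ r ∈ positive R f, F r := by
  rw [two_mul, ← Finset.sum_filter_add_sum_filter_not R (fun r ↦ 0 < f r), ← positive]
  congr 1
  refine Finset.sum_nbij' (fun r ↦ -r) (fun r ↦ -r) ?_ ?_ (by simp) (by simp) (by simp [hF])
  · intro r hr
    rw [Finset.mem_filter] at hr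
    have := hR.ne_zero r hr.1
    rw [mem_positive, map_neg]
    exact ⟨hR.neg_mem r hr.1, neg_pos.mpr (lt_of_le_of_ne (not_lt.mp hr.2) this)⟩
  · intro r hr
    rw [mem_positive] at hr
    rw [Finset.mem_filter, map_neg]
    exact ⟨hR.neg_mem r hr.1, by linarith⟩

lemma sum_positive_sq (hR : IsRootSystem R B f h) (v : V) :
    ∑ r ∈ positive R f, B r v ^ 2 = h * B v v := by
  have h1 := hR.sum_even (F := fun r ↦ B r v ^ 2) (by simp)
  rw [hR.sum_sq] at h1
  linarith

lemma card_positive (hR : IsRootSystem R B f h) : ((positive R f).card : ℚ) = 12 * h := by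
  have h1 := hR.sum_even (F := fun _ ↦ 1) (by simp)
  simp only [Finset.sum_const, nsmul_eq_mul, mul_one, hR.card_eq] at h1
  linarith

lemma apply_positive (hR : IsRootSystem R B f h) {r s : V} (hr : r ∈ positive R f)
    (hs : s ∈ positive R f) : r = s ∧ B r s = 2 ∨ r ≠ s ∧ B r s = 0 ∨ r ≠ s ∧ B r s = 1 ∨
      r ≠ s ∧ B r s = -1 := by
  rw [mem_positive] at hr hs
  by_cases hrs : r = s
  · exact .inl ⟨hrs, by rw [hrs, hR.norm s hs.1]⟩
  rcases hR.apply_cases hr.1 hs.1 with h | rfl | h | h | h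
  · exact absurd h hrs
  · have := hr.2
    rw [map_neg] at this
    linarith [hs.2]
  all_goals simp [hrs, h]

lemma sum_apply_positive (hR : IsRootSystem R B f h) {s : V} (hs : s ∈ positive R f) :
    ∑ r ∈ positive R f, B r s = 2 + #{r ∈ positive R f | B r s = 1}
      - #{r ∈ positive R f | B r s = -1} := by
  classical
  have h1 : ∀ r ∈ positive R f, B r s = (if r = s then 2 else 0) + (if B r s = 1 then 1 else 0) -
      (if B r s = -1 then 1 else 0) := by
    intro r hr
    rcases hR.apply_positive hr hs with ⟨h, h'⟩ | ⟨h, h'⟩ | ⟨h, h'⟩ | ⟨h, h'⟩ <;> rw [h'] <;>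
      norm_num [h]
  rw [Finset.sum_congr rfl h1, Finset.sum_sub_distrib, Finset.sum_add_distrib, Finset.sum_boole,
    Finset.sum_boole, Finset.sum_ite_eq', if_pos hs]

lemma card_add_card (hR : IsRootSystem R B f h) {s : V} (hs : s ∈ positive R f) :
    4 + (#{r ∈ positive R f | B r s = 1} : ℚ) + #{r ∈ positive R f | B r s = -1} = 2 * h := by
  classical
  have h1 : ∀ r ∈ positive R f, B r s ^ 2 = (if r = s then 4 else 0) +
      (if B r s = 1 then 1 else 0) + (if B r s = -1 then 1 else 0) := by
    intro r hr
    rcases hR.apply_positive hr hs with ⟨h, h'⟩ | ⟨h, h'⟩ | ⟨h, h'⟩ | ⟨h, h'⟩ <;> rw [h'] <;>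
      norm_num [h]
  have h2 := hR.sum_positive_sq s
  rw [Finset.sum_congr rfl h1, Finset.sum_add_distrib, Finset.sum_add_distrib, Finset.sum_boole,
    Finset.sum_boole, Finset.sum_ite_eq', if_pos hs, hR.norm s (mem_positive.mp hs).1] at h2
  linarith

lemma add_mem_positive (hR : IsRootSystem R B f h) {r s : V} (hr : r ∈ positive R f)
    (hs : s ∈ positive R f) (hrs : B r s = -1) : r + s ∈ positive R f := by
  rw [mem_positive] at hr hs ⊢
  exact ⟨hR.add_mem r hr.1 s hs.1 hrs, by rw [map_add]; linarith [hr.2, hs.2]⟩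

lemma card_neg_one_le (hR : IsRootSystem R B f h) {s : V} (hs : s ∈ positive R f) :
    #{r ∈ positive R f | B r s = -1} ≤ #{r ∈ positive R f | B r s = 1} := by
  refine Finset.card_le_card_of_injOn (fun r ↦ r + s) ?_ (add_left_injective s).injOn
  intro r hr
  rw [Finset.mem_coe, Finset.mem_filter] at hr ⊢
  refine ⟨hR.add_mem_positive hr.1 hs hr.2, ?_⟩
  rw [map_add, LinearMap.add_apply, hr.2, hR.norm s (mem_positive.mp hs).1]
  norm_num

lemma one_le_weyl_apply (hR : IsRootSystem R B f h) {s : V} (hs : s ∈ positive R f) :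
    1 ≤ B (weyl R f) s := by
  rw [weyl_apply, hR.sum_apply_positive hs]
  have h1 : (#{r ∈ positive R f | B r s = -1} : ℚ) ≤ #{r ∈ positive R f | B r s = 1} := by
    exact_mod_cast hR.card_neg_one_le hs
  linarith

lemma weyl_apply_le (hR : IsRootSystem R B f h) {s : V} (hs : s ∈ positive R f) :
    B (weyl R f) s ≤ h - 1 := by
  rw [weyl_apply, hR.sum_apply_positive hs]
  have h1 := hR.card_add_card hs
  have h2 : (0 : ℚ) ≤ #{r ∈ positive R f | B r s = -1} := by positivity
  linarith

/-- Among the pairs of positive roots, those with inner product `1` are twice as many as those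
with inner product `-1`. -/
lemma sum_card_eq (hR : IsRootSystem R B f h) :
    ∑ s ∈ positive R f, #{r ∈ positive R f | B r s = 1} =
      2 * ∑ s ∈ positive R f, #{r ∈ positive R f | B r s = -1} := by
  set P := positive R f
  have hcard : ∀ q : ℚ, ∑ s ∈ P, #{r ∈ P | B r s = q} = #{x ∈ P ×ˢ P | B x.2 x.1 = q} := by
    intro q
    simp only [Finset.card_filter, Finset.sum_product]
  rw [hcard, hcard, ← Finset.card_filter_add_card_filter_not (s := {x ∈ P ×ˢ P | B x.2 x.1 = 1})
    (fun x ↦ f x.1 < f x.2), two_mul]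
  have hlt : #{x ∈ {x ∈ P ×ˢ P | B x.2 x.1 = 1} | f x.1 < f x.2} =
      #{x ∈ P ×ˢ P | B x.2 x.1 = -1} := by
    refine Finset.card_nbij' (fun x ↦ (x.1, x.2 - x.1)) (fun x ↦ (x.1, x.2 + x.1)) ?_ ?_
      (fun x _ ↦ by simp) (fun x _ ↦ by simp)
    · rintro ⟨s, r⟩ hx
      simp only [Finset.mem_coe, Finset.mem_filter, Finset.mem_product] at hx ⊢
      obtain ⟨⟨⟨hs, hr⟩, hrs⟩, hlt⟩ := hx
      have hs' := mem_positive.mp hs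
      have hr' := mem_positive.mp hr
      refine ⟨⟨hs, mem_positive.mpr ⟨hR.sub_mem hr'.1 hs'.1 hrs, ?_⟩⟩, ?_⟩
      · rw [map_sub]
        linarith
      · rw [map_sub, LinearMap.sub_apply, hrs, hR.norm s hs'.1]
        norm_num
    · rintro ⟨s, r⟩ hx
      simp only [Finset.mem_coe, Finset.mem_filter, Finset.mem_product] at hx ⊢
      obtain ⟨⟨hs, hr⟩, hrs⟩ := hx
      refine ⟨⟨⟨hs, hR.add_mem_positive hr hs hrs⟩, ?_⟩, ?_⟩
      · rw [map_add, LinearMap.add_apply, hrs, hR.norm s (mem_positive.mp hs).1]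
        norm_num
      · rw [map_add]
        linarith [(mem_positive.mp hr).2]
  have hge : #{x ∈ {x ∈ P ×ˢ P | B x.2 x.1 = 1} | ¬ f x.1 < f x.2} =
      #{x ∈ {x ∈ P ×ˢ P | B x.2 x.1 = 1} | f x.1 < f x.2} := by
    refine Finset.card_nbij' Prod.swap Prod.swap ?_ ?_ (fun x _ ↦ x.swap_swap)
      (fun x _ ↦ x.swap_swap)
    · rintro ⟨s, r⟩ hx
      simp only [Finset.mem_coe, Finset.mem_filter, Finset.mem_product, Prod.swap] at hx ⊢
      obtain ⟨⟨⟨hs, hr⟩, hrs⟩, hlt⟩ := hx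
      refine ⟨⟨⟨hr, hs⟩, by rw [hR.symm, hrs]⟩, lt_of_le_of_ne (not_lt.mp hlt) fun heq ↦ ?_⟩
      refine hR.ne_zero _ (hR.sub_mem (mem_positive.mp hr).1 (mem_positive.mp hs).1 hrs) ?_
      rw [map_sub, heq, sub_self]
    · rintro ⟨s, r⟩ hx
      simp only [Finset.mem_coe, Finset.mem_filter, Finset.mem_product, Prod.swap] at hx ⊢
      obtain ⟨⟨⟨hs, hr⟩, hrs⟩, hlt⟩ := hx
      exact ⟨⟨⟨hr, hs⟩, by rw [hR.symm, hrs]⟩, hlt.le.not_gt⟩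
  rw [hge, hlt]

/-- The strange formula of Freudenthal and de Vries. -/
lemma weyl_norm (hR : IsRootSystem R B f h) : B (weyl R f) (weyl R f) = 2 * h * (h + 1) := by
  have h0 : B (weyl R f) (weyl R f) =
      4⁻¹ * ∑ s ∈ positive R f, ∑ r ∈ positive R f, B r s := by
    rw [weyl_apply]
    simp only [hR.symm _ (weyl R f), weyl_apply, ← Finset.mul_sum]
    ring
  have h1 := Finset.sum_congr rfl fun s (hs : s ∈ positive R f) ↦ hR.sum_apply_positive hs
  have h2 := Finset.sum_congr rfl fun s (hs : s ∈ positive R f) ↦ hR.card_add_card hs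
  have h3 := congrArg (Nat.cast : ℕ → ℚ) hR.sum_card_eq
  simp only [Finset.sum_sub_distrib, Finset.sum_add_distrib, Finset.sum_const, nsmul_eq_mul,
    hR.card_positive] at h1 h2
  push_cast at h3
  rw [h0, h1]
  linarith

lemma norm_weyl_sub (hR : IsRootSystem R B f h) (y : V) :
    B (weyl R f - h • y) (weyl R f - h • y) = 2 * h * (h + 1) + h * defect R B f y := by
  have h1 := hR.sum_positive_sq y
  have h2 := weyl_apply (R := R) (B := B) (f := f) y
  simp only [hR.symm _ y] at h1 h2
  simp only [defect, map_sub, LinearMap.sub_apply, map_smul, LinearMap.smul_apply, smul_eq_mul,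
    hR.weyl_norm, hR.symm (weyl R f) y, h2, Finset.sum_sub_distrib, h1]
  ring

lemma defect_add (hR : IsRootSystem R B f h) (h0 : h ≠ 0) (y z : V) :
    defect R B f (y + z) = defect R B f y + 2 * h * B y z + h * B z z - 2 * B (weyl R f) z := by
  have h1 := hR.norm_weyl_sub y
  have h2 := hR.norm_weyl_sub (y + z)
  simp only [map_sub, LinearMap.sub_apply, map_smul, LinearMap.smul_apply, smul_eq_mul, smul_add,
    map_add, LinearMap.add_apply, hR.symm y (weyl R f), hR.symm z (weyl R f), hR.symm z y]
    at h1 h2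
  refine mul_left_cancel₀ h0 ?_
  linear_combination h1 - h2

lemma sq_sub_nonneg {q : ℚ} (hq : ∃ n : ℤ, q = n) : 0 ≤ q ^ 2 - q := by
  obtain ⟨n, rfl⟩ := hq
  have : 0 ≤ n ^ 2 - n := by
    rw [sq, ← mul_sub_one]
    rcases le_or_gt n 0 with h | h
    · exact mul_nonneg_of_nonpos_of_nonpos h (by lia)
    · exact mul_nonneg h.le (by lia)
  exact_mod_cast this

lemma defect_nonneg {y : V} (hy : ∀ r ∈ R, ∃ n : ℤ, B y r = n) : 0 ≤ defect R B f y :=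
  Finset.sum_nonneg fun r hr ↦ sq_sub_nonneg (hy r (mem_positive.mp hr).1)

lemma defect_eq_zero_iff {y : V} (hy : ∀ r ∈ R, ∃ n : ℤ, B y r = n) :
    defect R B f y = 0 ↔ ∀ r ∈ positive R f, B y r = 0 ∨ B y r = 1 := by
  rw [defect, Finset.sum_eq_zero_iff_of_nonneg
    fun r hr ↦ sq_sub_nonneg (hy r (mem_positive.mp hr).1)]
  refine forall₂_congr fun r _ ↦ ?_
  rw [sq, ← mul_sub_one, mul_eq_zero, sub_eq_zero]

lemma exists_defect_eq_zero (hR : IsRootSystem R B f h) (h0 : 0 < h) {x : V}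
    (hx : ∀ r ∈ R, ∃ n : ℤ, B x r = n) :
    ∃ z ∈ Submodule.span ℤ (R : Set V), defect R B f (x + z) = 0 := by
  obtain ⟨n, hn⟩ := exists_nat_ge (defect R B f x)
  induction n generalizing x with
  | zero =>
    refine ⟨0, zero_mem _, ?_⟩
    rw [add_zero]
    exact le_antisymm (by simpa using hn) (defect_nonneg hx)
  | succ n ih =>
    by_cases hD : defect R B f x = 0
    · exact ⟨0, zero_mem _, by rwa [add_zero]⟩
    have hstep : ∀ s ∈ R, defect R B f (x + s) ≤ defect R B f x - 2 →
        ∃ z ∈ Submodule.span ℤ (R : Set V), defect R B f (x + z) = 0 := by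
      intro s hs hle
      obtain ⟨z, hz, hxz⟩ := @ih (x + s) (fun r hr ↦ by
        obtain ⟨a, ha⟩ := hx r hr
        obtain ⟨b, hb⟩ := hR.int s hs r hr
        exact ⟨a + b, by simp [ha, hb]⟩) (by
          push_cast at hn
          linarith)
      exact ⟨s + z, Submodule.add_mem _ (Submodule.subset_span hs) hz, by rwa [← add_assoc]⟩
    rw [defect_eq_zero_iff hx] at hD
    push Not at hD
    obtain ⟨r, hr, hr0, hr1⟩ := hD
    have hrR := (mem_positive.mp hr).1
    obtain ⟨k, hk⟩ := hx r hrR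
    have h1 := hR.one_le_weyl_apply hr
    have h2 := hR.weyl_apply_le hr
    rw [hk] at hr0 hr1
    have hk' : k ≤ -1 ∨ 2 ≤ k := by
      have hk0 : k ≠ 0 := by exact_mod_cast hr0
      have hk1 : k ≠ 1 := by exact_mod_cast hr1
      lia
    rcases hk' with hk' | hk'
    · refine hstep r hrR ?_
      rw [hR.defect_add h0.ne', hR.norm r hrR, hk]
      have : (k : ℚ) ≤ -1 := by exact_mod_cast hk'
      nlinarith
    · refine hstep (-r) (hR.neg_mem r hrR) ?_
      rw [hR.defect_add h0.ne', hR.norm _ (hR.neg_mem r hrR), map_neg, map_neg, hk]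
      have : (2 : ℚ) ≤ k := by exact_mod_cast hk'
      nlinarith

lemma exists_multiset (hR : IsRootSystem R B f h) {d : V}
    (hd : d ∈ Submodule.span ℤ (R : Set V)) : ∃ s : Multiset V, (∀ r ∈ s, r ∈ R) ∧ s.sum = d := by
  rw [← Submodule.mem_toAddSubgroup, Submodule.span_int_eq_addSubgroupClosure] at hd
  induction hd using AddSubgroup.closure_induction with
  | mem x hx => exact ⟨{x}, by simpa using hx, by simp⟩
  | zero => exact ⟨0, by simp, by simp⟩
  | add x y _ _ hx hy =>
    obtain ⟨s, hs, rfl⟩ := hx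
    obtain ⟨t, ht, rfl⟩ := hy
    refine ⟨s + t, fun r hr ↦ ?_, Multiset.sum_add s t⟩
    exact (Multiset.mem_add.mp hr).elim (hs r) (ht r)
  | neg x _ hx =>
    obtain ⟨s, hs, rfl⟩ := hx
    refine ⟨s.map (-·), fun r hr ↦ ?_, Multiset.sum_map_neg' s⟩
    obtain ⟨t, ht, rfl⟩ := Multiset.mem_map.mp hr
    exact hR.neg_mem t (hs t ht)

lemma multiset_sum_eq_zero (hR : IsRootSystem R B f h) (s : Multiset V) (hs : ∀ r ∈ s, r ∈ R)
    (hle : ∀ r ∈ R, B s.sum r ≤ 1) : s.sum = 0 := by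
  induction hn : s.card using Nat.strong_induction_on generalizing s with
  | _ n ih =>
    subst hn
    rcases s.empty_or_exists_mem with rfl | ⟨r, hr⟩
    · simp
    obtain ⟨t, rfl⟩ := Multiset.exists_cons_of_mem hr
    have hrR := hs r hr
    by_cases hneg : ∃ x ∈ t, B x r < 0
    · obtain ⟨x, hx, hxr⟩ := hneg
      obtain ⟨u, rfl⟩ := Multiset.exists_cons_of_mem hx
      have hxR := hs x (by simp)
      rcases hR.apply_cases hxR hrR with rfl | rfl | h | h | h
      · rw [hR.norm x hrR] at hxr
        norm_num at hxr
      · have hsum : (r ::ₘ -r ::ₘ u).sum = u.sum := by simp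
        rw [hsum] at hle ⊢
        exact ih _ (by simp) u (fun y hy ↦ hs y (by simp [hy])) hle rfl
      · rw [h] at hxr
        norm_num at hxr
      · rw [h] at hxr
        norm_num at hxr
      · have hsum : (r ::ₘ x ::ₘ u).sum = ((x + r) ::ₘ u).sum := by
          simp only [Multiset.sum_cons]
          abel
        rw [hsum] at hle ⊢
        refine ih _ (by simp) _ (fun y hy ↦ ?_) hle rfl
        rcases Multiset.mem_cons.mp hy with rfl | hy
        · exact hR.add_mem x hxR r hrR h
        · exact hs y (by simp [hy])
    · push Not at hneg
      have h1 := hle r hrR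
      have h2 : 0 ≤ B t.sum r := by
        rw [← LinearMap.flip_apply, map_multiset_sum]
        refine Multiset.sum_nonneg fun q hq ↦ ?_
        obtain ⟨x, hx, rfl⟩ := Multiset.mem_map.mp hq
        exact hneg x hx
      rw [Multiset.sum_cons, map_add, LinearMap.add_apply, hR.norm r hrR] at h1
      linarith

/-- Distinct vectors of defect zero lie in different classes modulo the root lattice. -/
lemma eq_of_defect_eq_zero (hR : IsRootSystem R B f h) {y z : V}
    (hy : ∀ r ∈ R, ∃ n : ℤ, B y r = n) (hz : ∀ r ∈ R, ∃ n : ℤ, B z r = n)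
    (hy0 : defect R B f y = 0) (hz0 : defect R B f z = 0)
    (hyz : y - z ∈ Submodule.span ℤ (R : Set V)) : y = z := by
  rw [defect_eq_zero_iff hy] at hy0
  rw [defect_eq_zero_iff hz] at hz0
  obtain ⟨s, hs, hsum⟩ := hR.exists_multiset hyz
  have hpos : ∀ r ∈ positive R f, -1 ≤ B (y - z) r ∧ B (y - z) r ≤ 1 := by
    intro r hr
    rw [map_sub, LinearMap.sub_apply]
    rcases hy0 r hr with h | h <;> rcases hz0 r hr with h' | h' <;> rw [h, h'] <;> norm_num
  rw [← sub_eq_zero, ← hsum]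
  refine hR.multiset_sum_eq_zero s hs fun r hr ↦ ?_
  rw [hsum]
  rcases lt_or_gt_of_ne (hR.ne_zero r hr) with h | h
  · have := (hpos (-r) (mem_positive.mpr ⟨hR.neg_mem r hr, by simpa using h⟩)).1
    rw [map_neg] at this
    linarith
  · exact (hpos r (mem_positive.mpr ⟨hr, h⟩)).2

end IsRootSystem

end RootSystem

section Roots

variable {V : Type*} [AddCommGroup V] [Module ℚ V]
variable {L : Submodule ℤ V} {B : V →ₗ[ℚ] V →ₗ[ℚ] ℚ}

lemma IsNiemeier.isRootSystem (hN : IsNiemeier L B) {R : Finset V}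
    (hR : ∀ r, r ∈ R ↔ r ∈ L ∧ B r r = 2)
    (hsum : ∀ v, ∑ r ∈ R, B r v ^ 2 = (R.card : ℚ) / 12 * B v v)
    {f : V →ₗ[ℚ] ℚ} (hf : ∀ x ∈ L, B x x = 2 → f x ≠ 0) :
    IsRootSystem R B f ((R.card : ℚ) / 24) where
  symm := hN.symm
  pos _ hx := hN.pos_of_ne_zero hx
  norm r hr := ((hR r).mp hr).2
  int r hr s hs := hN.int r ((hR r).mp hr).1 s ((hR s).mp hs).1
  neg_mem r hr := by
    rw [hR] at hr ⊢
    exact ⟨neg_mem hr.1, by simp [hr.2]⟩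
  add_mem r hr s hs hrs := by
    rw [hR] at hr hs ⊢
    refine ⟨add_mem hr.1 hs.1, ?_⟩
    simp only [map_add, LinearMap.add_apply, hr.2, hs.2, hrs, hN.symm s r]
    norm_num
  ne_zero r hr := hf r ((hR r).mp hr).1 ((hR r).mp hr).2
  card_eq := by ring
  sum_sq v := by
    rw [hsum]
    ring

end Roots

end Niemeier

/-- For a Niemeier lattice `N` with nonempty root set `R`, Coxeter number `h = |R|/24`, and
Weyl vector `ρ`: every `y ∈ N` satisfies `(ρ − h·y)² ≥ 2h(h+1)`, with equality iff
`B(y,r) ∈ {0,1}` for every positive root `r`; and the `y` attaining equality form a complete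
set of representatives of `N` modulo the ℤ-span of `R`. -/
theorem niemeier_deep_hole_bound_and_coset_representatives
    (V : Type*) [AddCommGroup V] [Module ℚ V]
    (L : Submodule ℤ V) (hfg : L.FG)
    (hspan : Submodule.span ℚ (L : Set V) = ⊤)
    (hrank : Module.finrank ℚ V = 24)
    (B : V →ₗ[ℚ] V →ₗ[ℚ] ℚ)
    (hsymm : ∀ x y : V, B x y = B y x)
    (hint : ∀ x ∈ L, ∀ y ∈ L, ∃ n : ℤ, B x y = (n : ℚ))
    (hpos : ∀ x ∈ L, x ≠ 0 → 0 < B x x)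
    (heven : ∀ x ∈ L, ∃ n : ℤ, B x x = 2 * (n : ℚ))
    (hunimod : ∀ v : V, (∀ y ∈ L, ∃ n : ℤ, B v y = (n : ℚ)) → v ∈ L)
    (hne : {x : V | x ∈ L ∧ B x x = 2}.Nonempty)
    (f : V →ₗ[ℚ] ℚ)
    (hf : ∀ x ∈ L, B x x = 2 → f x ≠ 0)
    (h : ℚ) (hh : h = ({x : V | x ∈ L ∧ B x x = 2}.ncard : ℚ) / 24)
    (ρ : V)
    (hρ : ρ = (2⁻¹ : ℚ) • ∑ᶠ x ∈ {x : V | x ∈ L ∧ B x x = 2 ∧ 0 < f x}, x) :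
    (∀ y ∈ L, 2 * h * (h + 1) ≤ B (ρ - h • y) (ρ - h • y)) ∧
    (∀ y ∈ L,
      (B (ρ - h • y) (ρ - h • y) = 2 * h * (h + 1) ↔
        ∀ r ∈ L, B r r = 2 → 0 < f r → (B y r = 0 ∨ B y r = 1))) ∧
    (∀ x ∈ L, ∃! y : V, y ∈ L ∧
      B (ρ - h • y) (ρ - h • y) = 2 * h * (h + 1) ∧
      x - y ∈ Submodule.span ℤ {r : V | r ∈ L ∧ B r r = 2}) := by
  have hN : Niemeier.IsNiemeier L B :=
    ⟨hfg, hspan, hrank, hsymm, hint, hpos, heven, hunimod⟩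
  obtain ⟨R, hR, hsum⟩ := hN.exists_finset_roots_sum_sq
  have hRset : {x : V | x ∈ L ∧ B x x = 2} = (R : Set V) := Set.ext fun r ↦ (hR r).symm
  rw [hRset] at hne hh ⊢
  rw [Set.ncard_coe_finset] at hh
  have hS := hN.isRootSystem hR hsum hf
  rw [← hh] at hS
  have h0 : 0 < h := by
    have : 0 < R.card := Finset.card_pos.mpr (Finset.coe_nonempty.mp hne)
    rw [hh]
    positivity
  have hPset : {x : V | x ∈ L ∧ B x x = 2 ∧ 0 < f x} = (Niemeier.positive R f : Set V) := by
    ext r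
    rw [Finset.mem_coe, Niemeier.mem_positive, hR, and_assoc]
    rfl
  have hweyl : ρ = Niemeier.weyl R f := by
    rw [hρ, hPset, finsum_mem_coe_finset, Niemeier.weyl]
  have hyR : ∀ y ∈ L, ∀ r ∈ R, ∃ n : ℤ, B y r = n := fun y hy r hr ↦
    hint y hy r ((hR r).mp hr).1
  have heq : ∀ y, B (ρ - h • y) (ρ - h • y) = 2 * h * (h + 1) ↔ Niemeier.defect R B f y = 0 := by
    intro y
    rw [hweyl, hS.norm_weyl_sub, add_eq_left, mul_eq_zero, or_iff_right h0.ne']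
  refine ⟨fun y hy ↦ ?_, fun y hy ↦ ?_, fun x hx ↦ ?_⟩
  · rw [hweyl, hS.norm_weyl_sub]
    exact le_add_of_nonneg_right
      (mul_nonneg h0.le (Niemeier.IsRootSystem.defect_nonneg (hyR y hy)))
  · rw [heq, Niemeier.IsRootSystem.defect_eq_zero_iff (hyR y hy)]
    simp only [Niemeier.mem_positive, hR, and_imp]
  · simp only [heq]
    obtain ⟨z, hz, hxz⟩ := hS.exists_defect_eq_zero h0 (hyR x hx)
    have hzL : z ∈ L := Submodule.span_le.mpr (fun r hr ↦ ((hR r).mp hr).1) hz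
    refine ⟨x + z, ⟨add_mem hx hzL, hxz, ?_⟩, ?_⟩
    · rw [sub_add_cancel_left]
      exact neg_mem hz
    · rintro y ⟨hy, hy0, hxy⟩
      refine hS.eq_of_defect_eq_zero (hyR y hy) (hyR _ (add_mem hx hzL)) hy0 hxz ?_
      have : y - (x + z) = -(x - y) - z := by abel
      rw [this]
      exact sub_mem (neg_mem hxy) hz
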